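/- arXiv:1805.08424 — 2 statements merged into one kernel-verified Lean document; each statement's English description precedes it below -/
import Mathlib

section
/- For all d ∈ (0,1] and r, C, f, h ∈ ℕ there exists ε₀ > 0; for every 0 < ε ≤ ε₀ there exists ζ₀ > 0; for every 0 < ζ ≤ ζ₀ there exists n₀ ∈ ℕ such that the following holds for all n ≥ n₀. Let F be a graph with h edges and a vertex partition 𝒳 = {X₁,…,X_r} into independent sets each of size f, and let G be a graph with a vertex partition 𝒱 = {V₁,…,V_r} into independent sets. Suppose φ is an edge-colouring of G that is Cn-bounded and locally ζn-bounded, and fix j', j'' ∈ [r] and an edge vw of G with v ∈ V_{j'} and w ∈ V_{j''}. Assume: (A1) |V_i| = (1±ζ)n for each i ∈ [r]; (A2) G[V_i,V_j] is (ζ,d)-superregular for all i ≠ j ∈ [r]; (A3) either |N_G(v)∩N_G(w)∩V_i| = (d²±ζ)|V_i| for all i ∈ [r]∖{j',j''} and vw is not an edge of Ir^φ_G(ζn), or F is triangle-free. Then for every vertex u of G: r_{G,𝒳,𝒱}(F,u) = (1±ε)·r!·f·d^h·n^{fr−1}/|Aut_𝒳(F)|, and r_{G,𝒳,𝒱}(F,vw)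 = (1±ε)·r!·h·d^{h−1}·n^{fr−2}/(C(r,2)·|Aut_𝒳(F)|), where C(r,2) = r(r−1)/2. -/
namespace Paper

variable {V : Type*} {W : Type*} {C : Type*}

/-- The set of edges of `G` receiving colour `c` under `φ`. -/
def colourCls (G : SimpleGraph V) (φ : Sym2 V → C) (c : C) : Set (Sym2 V) :=
  {e | e ∈ G.edgeSet ∧ φ e = c}

/-- `φ` is a (globally) `g`-bounded edge-colouring of `G`:
every colour is used on at most `g` edges. -/
def GBounded (G : SimpleGraph V) (φ : Sym2 V → C) (g : ℝ) : Prop :=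
  ∀ c : C, ((colourCls G φ c).ncard : ℝ) ≤ g

/-- `φ` is a locally `l`-bounded edge-colouring of `G`:
every vertex is incident to at most `l` edges of each colour. -/
def LBounded (G : SimpleGraph V) (φ : Sym2 V → C) (l : ℝ) : Prop :=
  ∀ (v : V) (c : C), (({u | G.Adj v u ∧ φ s(v, u) = c}).ncard : ℝ) ≤ l

/-- A set of edges is rainbow if the colouring is injective on it. -/
def Rainbow (φ : Sym2 V → C) (E : Set (Sym2 V)) : Prop :=
  Set.InjOn φ E

/-- The set of common neighbours `w` of `u` and `v` with `φ(uw) = φ(vw)`. -/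
def monoSet (G : SimpleGraph V) (φ : Sym2 V → C) (u v : V) : Set V :=
  {w | G.Adj u w ∧ G.Adj v w ∧ φ s(u, w) = φ s(v, w)}

/-- The monochromatic codegree `c^φ_G(u,v)`. -/
noncomputable def monoCodeg (G : SimpleGraph V) (φ : Sym2 V → C) (u v : V) : ℕ :=
  (monoSet G φ u v).ncard

/-- Degree of `u` into the set `S`. -/
noncomputable def degIn (G : SimpleGraph V) (u : V) (S : Set V) : ℕ :=
  (G.neighborSet u ∩ S).ncard

/-- Codegree of `u,v` into the set `S`. -/
noncomputable def codegIn (G : SimpleGraph V) (u v : V) (S : Set V) : ℕ :=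
  (G.neighborSet u ∩ G.neighborSet v ∩ S).ncard

/-- `G` restricted to `S` is `(ε,d)`-quasirandom: all degrees (within `S`)
are `(d ± ε)|S|` and all but at most `ε|S|²` unordered pairs of distinct
vertices of `S` have codegree (within `S`) equal to `(d² ± ε)|S|`. -/
def QuasirandomOn (G : SimpleGraph V) (S : Set V) (ε d : ℝ) : Prop :=
  (∀ v ∈ S, |(degIn G v S : ℝ) - d * S.ncard| ≤ ε * S.ncard) ∧
  ((({p : Sym2 V | ∃ u v, p = s(u, v) ∧ u ≠ v ∧ u ∈ S ∧ v ∈ S ∧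
        ¬ (|(codegIn G u v S : ℝ) - d ^ 2 * S.ncard| ≤ ε * S.ncard)}).ncard : ℝ)
      ≤ ε * (S.ncard : ℝ) ^ 2)

/-- `G` is `(ε,d)`-quasirandom. -/
def Quasirandom (G : SimpleGraph V) (ε d : ℝ) : Prop :=
  QuasirandomOn G Set.univ ε d

/-- Edges of `G` with one endpoint in `X` and the other in `Y`. -/
def edgesBetween (G : SimpleGraph V) (X Y : Set V) : Set (Sym2 V) :=
  {e | e ∈ G.edgeSet ∧ ∃ u v, e = s(u, v) ∧ u ∈ X ∧ v ∈ Y}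

/-- The pair `(A,B)` is `(ε,d)`-regular in `G`. -/
def RegularPair (G : SimpleGraph V) (A B : Set V) (ε d : ℝ) : Prop :=
  ∀ X ⊆ A, ∀ Y ⊆ B, ε * A.ncard ≤ (X.ncard : ℝ) → ε * B.ncard ≤ (Y.ncard : ℝ) →
    |((edgesBetween G X Y).ncard : ℝ) / ((X.ncard : ℝ) * (Y.ncard : ℝ)) - d| ≤ ε

/-- The pair `(A,B)` is `(ε,d)`-superregular in `G`. -/
def SuperregularPair (G : SimpleGraph V) (A B : Set V) (ε d : ℝ) : Prop :=
  RegularPair G A B ε d ∧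
  (∀ u ∈ A, |(degIn G u B : ℝ) - d * B.ncard| ≤ ε * B.ncard) ∧
  (∀ v ∈ B, |(degIn G v A : ℝ) - d * A.ncard| ≤ ε * A.ncard)

/-- `H` is a copy of `F`: a subgraph of `G` isomorphic to `F`. -/
def IsCopy (F : SimpleGraph W) {G : SimpleGraph V} (H : G.Subgraph) : Prop :=
  Nonempty (F ≃g H.coe)

/-- `L` is the union of the family `𝒞` of pairwise vertex-disjoint copies of `F`. -/
def IsFactorFrom (F : SimpleGraph W) {G : SimpleGraph V} (L : G.Subgraph)
    (𝒞 : Set G.Subgraph) : Prop :=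
  (∀ H ∈ 𝒞, IsCopy F H) ∧
  𝒞.Pairwise (fun H₁ H₂ => Disjoint H₁.verts H₂.verts) ∧
  L = sSup 𝒞

/-- `L` consists of vertex-disjoint copies of `F`. -/
def IsFFactorSub (F : SimpleGraph W) {G : SimpleGraph V} (L : G.Subgraph) : Prop :=
  ∃ 𝒞 : Set G.Subgraph, IsFactorFrom F L 𝒞

/-- An `ε`-decomposition: pairwise edge-disjoint subgraphs of `G` which together
contain all but at most an `ε`-proportion of the edges of `G`. -/
def ApxDecomp (G : SimpleGraph V) (ε : ℝ) {t : ℕ} (L : Fin t → G.Subgraph) : Prop :=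
  (Pairwise fun i j => Disjoint (L i).edgeSet (L j).edgeSet) ∧
  ((G.edgeSet \ ⋃ i, (L i).edgeSet).ncard : ℝ) ≤ ε * (G.edgeSet.ncard : ℝ)

/-- `a(F) ≤ a`, where `a(F) = max {Δ(F), a'(F), a''(F)}`. -/
def AParamLe (F : SimpleGraph W) (a : ℕ) : Prop :=
  (∀ v, (F.neighborSet v).ncard ≤ a) ∧
  (∀ u v, F.Adj u v →
    (F.neighborSet u).ncard + (F.neighborSet v).ncard - 2 ≤ a) ∧
  (∀ u v w, F.Adj u v → F.Adj v w → u ≠ w →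
    (F.neighborSet u).ncard + (F.neighborSet v).ncard + (F.neighborSet w).ncard - 4 ≤ a)

end Paper

open Paper

/-- The number of `φ`-rainbow copies of `F` in `G` which respect `(𝒳,𝒱)` and satisfy
the additional containment condition `P`. -/
noncomputable def rCount {V W : Type*} {r : ℕ} (F : SimpleGraph W) (𝒳 : Fin r → Set W)
    (G : SimpleGraph V) (𝒱 : Fin r → Set V) (φ : Sym2 V → ℕ)
    (P : G.Subgraph → Prop) : ℕ :=
  ({H : G.Subgraph | Rainbow φ H.edgeSet ∧ P H ∧
      ∃ (e : F ≃g H.coe) (π : Fin r → Fin r), Function.Injective π ∧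
        ∀ i, ∀ x ∈ 𝒳 i, ((e x : H.verts) : V) ∈ 𝒱 (π i)}).ncard

/-- The number of automorphisms `π` of `F` with `{π(X₁),…,π(X_r)} = {X₁,…,X_r}`. -/
noncomputable def autXCard {W : Type*} {r : ℕ} (F : SimpleGraph W)
    (𝒳 : Fin r → Set W) : ℕ :=
  Nat.card {π : F ≃g F //
    (∀ i, ∃ j, (fun x => π x) '' 𝒳 i = 𝒳 j) ∧ (∀ j, ∃ i, (fun x => π x) '' 𝒳 i = 𝒳 j)}

theorem sum_piFinset_update {W V : Type*} [Fintype W] [DecidableEq W]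
    (S : W → Finset V) (a : W) (v₀ : V) (g : (W → V) → ℝ) :
    ∑ ψ ∈ Fintype.piFinset S, g ψ =
      ∑ ρ ∈ Fintype.piFinset (Function.update S a {v₀}), ∑ x ∈ S a,
        g (Function.update ρ a x) := by
  rw [← Finset.sum_product']
  refine Finset.sum_nbij' (fun ψ => (Function.update ψ a v₀, ψ a))
    (fun q => Function.update q.1 a q.2) ?_ ?_ ?_ ?_ ?_
  · intro ψ hψ
    rw [Fintype.mem_piFinset] at hψ
    simp only [Finset.mem_product, Fintype.mem_piFinset]
    refine ⟨fun c => ?_, hψ a⟩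
    rcases eq_or_ne c a with rfl | hc
    · simp
    · simpa [hc] using hψ c
  · rintro ⟨ρ, x⟩ h
    simp only [Finset.mem_product, Fintype.mem_piFinset] at h ⊢
    intro c
    rcases eq_or_ne c a with rfl | hc
    · simpa using h.2
    · simpa [hc] using h.1 c
  · intro ψ _
    simp
  · rintro ⟨ρ, x⟩ h
    simp only [Finset.mem_product, Fintype.mem_piFinset] at h
    have := h.1 a
    simp only [Function.update_self, Finset.mem_singleton] at this
    simp [← this]
  · intro ψ _
    simp

theorem card_piFinset_update {W V : Type*} [Fintype W] [DecidableEq W]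
    (S : W → Finset V) (a : W) (v₀ : V) :
    (Fintype.piFinset (Function.update S a {v₀})).card =
      ∏ c ∈ Finset.univ.erase a, (S c).card := by
  rw [Fintype.card_piFinset, ← Finset.mul_prod_erase _ _ (Finset.mem_univ a)]
  simp only [Function.update_self, Finset.card_singleton, one_mul]
  refine Finset.prod_congr rfl fun c hc => ?_
  rw [Function.update_of_ne (Finset.ne_of_mem_erase hc)]

open Classical in
theorem card_filter_piFinset_le {W V : Type*} [Fintype W] [DecidableEq W] [Nonempty V]
    (S : W → Finset V) (a : W) (Q : (W → V) → Prop) [DecidablePred Q]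
    (m : ℝ)
    (h : ∀ ρ : W → V, (∀ c, c ≠ a → ρ c ∈ S c) →
      (((S a).filter fun x => Q (Function.update ρ a x)).card : ℝ) ≤ m) :
    (((Fintype.piFinset S).filter Q).card : ℝ) ≤
      m * ∏ c ∈ Finset.univ.erase a, ((S c).card : ℝ) := by
  obtain ⟨v₀⟩ := ‹Nonempty V›
  have e : (((Fintype.piFinset S).filter Q).card : ℝ) =
      ∑ ψ ∈ Fintype.piFinset S, if Q ψ then (1 : ℝ) else 0 := by simp
  rw [e, sum_piFinset_update S a v₀]
  calc _ ≤ ∑ ρ ∈ Fintype.piFinset (Function.update S a {v₀}), m := by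
        refine Finset.sum_le_sum fun ρ hρ => ?_
        rw [Fintype.mem_piFinset] at hρ
        have := h ρ fun c hc => by simpa [hc] using hρ c
        simpa using this
    _ = _ := by
        rw [Finset.sum_const, card_piFinset_update, nsmul_eq_mul, mul_comm]
        push_cast
        rfl

open Classical in
theorem abs_card_filter_adj_sub_le {W V : Type*} [Fintype W] [DecidableEq W] [Nonempty V]
    (S : W → Finset V) {a b : W} (hab : a ≠ b) (Q : (W → V) → Prop) [DecidablePred Q]
    (R : V → V → Prop) [DecidableRel R] (d δ : ℝ)
    (hQ : ∀ ρ : W → V, ∃ α β : V → Prop, ∀ x y,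
      Q (Function.update (Function.update ρ a x) b y) ↔ α x ∧ β y)
    (hR : ∀ X ⊆ S a, ∀ Y ⊆ S b,
      |(((X ×ˢ Y).filter fun p => R p.1 p.2).card : ℝ) - d * (X.card * Y.card)| ≤ δ) :
    |(((Fintype.piFinset S).filter fun ψ => Q ψ ∧ R (ψ a) (ψ b)).card : ℝ) -
        d * ((Fintype.piFinset S).filter Q).card| ≤
      δ * ∏ c ∈ (Finset.univ.erase a).erase b, ((S c).card : ℝ) := by
  obtain ⟨v₀⟩ := ‹Nonempty V›
  have e : ∀ (Q' : (W → V) → Prop) [DecidablePred Q'], (((Fintype.piFinset S).filter Q').card : ℝ) =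
      ∑ ρ ∈ Fintype.piFinset (Function.update (Function.update S b {v₀}) a {v₀}),
        (((S a ×ˢ S b).filter fun p => Q'
          (Function.update (Function.update ρ a p.1) b p.2)).card : ℝ) := by
    intro Q' _
    have e1 : (((Fintype.piFinset S).filter Q').card : ℝ) =
      ∑ ψ ∈ Fintype.piFinset S, if Q' ψ then (1 : ℝ) else 0 := by simp
    rw [e1, sum_piFinset_update S b v₀, sum_piFinset_update _ a v₀]
    refine Finset.sum_congr rfl fun ρ _ => ?_
    rw [Function.update_of_ne hab, ← Finset.sum_product']
    simp
  rw [e, e, Finset.mul_sum, ← Finset.sum_sub_distrib]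
  refine (Finset.abs_sum_le_sum_abs _ _).trans ?_
  calc _ ≤ ∑ ρ ∈ Fintype.piFinset (Function.update (Function.update S b {v₀}) a {v₀}), δ := by
        refine Finset.sum_le_sum fun ρ _ => ?_
        obtain ⟨α, β, hαβ⟩ := hQ ρ
        have := hR ((S a).filter α) (Finset.filter_subset _ _) ((S b).filter β)
          (Finset.filter_subset _ _)
        have h1 : ((S a ×ˢ S b).filter fun p =>
            Q (Function.update (Function.update ρ a p.1) b p.2) ∧
            R (Function.update (Function.update ρ a p.1) b p.2 a)
              (Function.update (Function.update ρ a p.1) b p.2 b)) =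
            ((S a).filter α ×ˢ (S b).filter β).filter fun p => R p.1 p.2 := by
          ext ⟨x, y⟩
          simp only [Finset.mem_filter, Finset.mem_product, hαβ, Function.update_self,
            Function.update_of_ne hab]
          tauto
        have h2 : ((S a ×ˢ S b).filter fun p =>
            Q (Function.update (Function.update ρ a p.1) b p.2)) =
            (S a).filter α ×ˢ (S b).filter β := by
          ext ⟨x, y⟩
          simp only [Finset.mem_filter, Finset.mem_product, hαβ]
          tauto
        rw [h1, h2, Finset.card_product]
        exact_mod_cast this
    _ = _ := by
        rw [Finset.sum_const, card_piFinset_update, nsmul_eq_mul, mul_comm,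
          ← Finset.mul_prod_erase _ _ (a := b) (by simp [hab.symm])]
        rw [Function.update_self, Finset.card_singleton, one_mul]
        push_cast
        congr 1
        refine Finset.prod_congr rfl fun c hc => ?_
        rw [Function.update_of_ne (by grind)]

open Classical in
/-- Telescoping over the edges. -/
theorem abs_card_filter_edges_sub_le {W V : Type*} [Fintype W] [DecidableEq W] [Nonempty V]
    (S : W → Finset V) (G : SimpleGraph V) (E : Finset (Sym2 W)) (d δ D : ℝ)
    (hd : 0 ≤ d) (hd1 : d ≤ 1)
    (hE : ∀ a b, s(a, b) ∈ E → a ≠ b ∧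
      δ * ∏ c ∈ (Finset.univ.erase a).erase b, ((S c).card : ℝ) ≤ D ∧
      ∀ X ⊆ S a, ∀ Y ⊆ S b,
        |(((X ×ˢ Y).filter fun p => G.Adj p.1 p.2).card : ℝ) - d * (X.card * Y.card)| ≤ δ) :
    |(((Fintype.piFinset S).filter fun ψ => ∀ e ∈ E, e.map ψ ∈ G.edgeSet).card : ℝ) -
        d ^ E.card * ∏ c, ((S c).card : ℝ)| ≤ E.card * D := by
  classical
  induction E using Finset.induction_on with
  | empty => simp
  | insert e E he ih =>
    have ih := ih fun a b hab => hE a b (Finset.mem_insert_of_mem hab)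
    induction e using Sym2.ind with
    | _ a b =>
    obtain ⟨hab, hδ, hX⟩ := hE a b (Finset.mem_insert_self _ _)
    have key := abs_card_filter_adj_sub_le S hab (fun ψ => ∀ e ∈ E, e.map ψ ∈ G.edgeSet)
      G.Adj d δ ?_ hX
    · have e1 : ((Fintype.piFinset S).filter fun ψ => ∀ e ∈ insert s(a, b) E,
          e.map ψ ∈ G.edgeSet) = (Fintype.piFinset S).filter fun ψ =>
            (∀ e ∈ E, e.map ψ ∈ G.edgeSet) ∧ G.Adj (ψ a) (ψ b) := by
        ext ψ
        simp [and_comm]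
      rw [e1, Finset.card_insert_of_notMem he, pow_succ]
      push_cast
      rw [abs_le] at *
      constructor <;> nlinarith
    · intro ρ
      refine ⟨fun x => ∀ e ∈ E, b ∉ e → e.map (Function.update ρ a x) ∈ G.edgeSet,
        fun y => ∀ e ∈ E, b ∈ e → e.map (Function.update ρ b y) ∈ G.edgeSet, fun x y => ?_⟩
      have h1 : ∀ e : Sym2 W, b ∉ e → e.map (Function.update (Function.update ρ a x) b y) =
          e.map (Function.update ρ a x) := fun e hb => Sym2.map_congr fun c hc => by
        rw [Function.update_of_ne]; rintro rfl; exact hb hc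
      have h2 : ∀ e ∈ E, b ∈ e → e.map (Function.update (Function.update ρ a x) b y) =
          e.map (Function.update ρ b y) := fun e heE hb => Sym2.map_congr fun c hc => by
        rw [Function.update_comm hab, Function.update_of_ne]
        rintro rfl
        exact he (((Sym2.mem_and_mem_iff hab).1 ⟨hc, hb⟩) ▸ heE)
      constructor
      · intro h
        exact ⟨fun e heE hb => h1 e hb ▸ h e heE, fun e heE hb => h2 e heE hb ▸ h e heE⟩
      · rintro ⟨h, h'⟩ e heE
        by_cases hb : b ∈ e
        · rw [h2 e heE hb]; exact h' e heE hb
        · rw [h1 e hb]; exact h e heE hb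

theorem abs_prod_sub_prod_le {ι : Type*} (s : Finset ι) (x y : ι → ℝ) (B η : ℝ)
    (hB : 0 ≤ B) (hη : 0 ≤ η) (hx : ∀ i ∈ s, 0 ≤ x i ∧ x i ≤ B) (hy : ∀ i ∈ s, 0 ≤ y i ∧ y i ≤ B)
    (h : ∀ i ∈ s, |x i - y i| ≤ η * B) :
    |∏ i ∈ s, x i - ∏ i ∈ s, y i| ≤ s.card * η * B ^ s.card := by
  classical
  induction s using Finset.induction_on with
  | empty => simp
  | insert a s ha ih =>
    rw [Finset.prod_insert ha, Finset.prod_insert ha, Finset.card_insert_of_notMem ha]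
    have ih := ih (fun i hi => hx i (by simp [hi])) (fun i hi => hy i (by simp [hi]))
      (fun i hi => h i (by simp [hi]))
    have h0 : 0 ≤ ∏ i ∈ s, x i := Finset.prod_nonneg fun i hi => (hx i (by simp [hi])).1
    have h1 : ∏ i ∈ s, x i ≤ B ^ s.card := by
      rw [← Finset.prod_const]
      exact Finset.prod_le_prod (fun i hi => (hx i (by simp [hi])).1)
        fun i hi => (hx i (by simp [hi])).2
    have ha1 := h a (by simp)
    have ha2 := hy a (by simp)
    calc _ = |(x a - y a) * ∏ i ∈ s, x i + y a * (∏ i ∈ s, x i - ∏ i ∈ s, y i)| := by ring_nf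
      _ ≤ |x a - y a| * ∏ i ∈ s, x i + y a * |∏ i ∈ s, x i - ∏ i ∈ s, y i| := by
        refine (abs_add_le _ _).trans_eq ?_
        rw [abs_mul, abs_mul, abs_of_nonneg h0, abs_of_nonneg ha2.1]
      _ ≤ (η * B) * B ^ s.card + B * (s.card * η * B ^ s.card) := by
        gcongr
        exact ha2.2
      _ = _ := by push_cast; ring

/-- The admissible images of `c` when the vertices in `P` are mapped according to `τ`. -/
noncomputable def pinnedTargets {W V : Type*} [DecidableEq W] (F : SimpleGraph W)
    (G : SimpleGraph V) (T : W → Finset V) (P : Finset W) (τ : W → V) (c : W) : Finset V :=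
  open Classical in
  if c ∈ P then {τ c} else (T c).filter fun z => ∀ p ∈ P, F.Adj p c → G.Adj (τ p) z

/-- The rainbow embeddings of `F` into `G` with target sets `T` that agree with `τ` on `P`. -/
def pinnedEmbeddings {W V : Type*} (F : SimpleGraph W) (G : SimpleGraph V) (φ : Sym2 V → ℕ)
    (T : W → Finset V) (P : Finset W) (τ : W → V) : Set (W → V) :=
  {ψ | (∀ c, ψ c ∈ T c) ∧ (∀ p ∈ P, ψ p = τ p) ∧ Function.Injective ψ ∧
    (∀ a b, F.Adj a b → G.Adj (ψ a) (ψ b)) ∧ Set.InjOn φ (Sym2.map ψ '' F.edgeSet)}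

theorem pinnedTargets_subset {W V : Type*} [DecidableEq W] {F : SimpleGraph W}
    {G : SimpleGraph V} {T : W → Finset V} {P : Finset W} {τ : W → V} {c : W} (hc : c ∉ P) :
    pinnedTargets F G T P τ c ⊆ T c := by
  intro z hz
  simp only [pinnedTargets, hc, if_false, Finset.mem_filter] at hz
  exact hz.1

theorem mem_piFinset_pinnedTargets {W V : Type*} [Fintype W] [DecidableEq W] {F : SimpleGraph W}
    {G : SimpleGraph V} {T : W → Finset V} {P : Finset W} {τ : W → V}
    (hτ : ∀ p ∈ P, τ p ∈ T p) {ψ : W → V} :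
    ψ ∈ Fintype.piFinset (pinnedTargets F G T P τ) ↔ (∀ c, ψ c ∈ T c) ∧ (∀ p ∈ P, ψ p = τ p) ∧
      ∀ c ∉ P, ∀ p ∈ P, F.Adj p c → G.Adj (ψ p) (ψ c) := by
  rw [Fintype.mem_piFinset]
  constructor
  · intro h
    have h1 : ∀ p ∈ P, ψ p = τ p := fun p hp => by simpa [pinnedTargets, hp] using h p
    have h2 : ∀ c ∉ P, ψ c ∈ T c ∧ ∀ p ∈ P, F.Adj p c → G.Adj (τ p) (ψ c) :=
      fun c hc => by simpa [pinnedTargets, hc] using h c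
    refine ⟨fun c => ?_, h1, fun c hc p hp hpc => h1 p hp ▸ (h2 c hc).2 p hp hpc⟩
    by_cases hc : c ∈ P
    · exact h1 c hc ▸ hτ c hc
    · exact (h2 c hc).1
  · rintro ⟨h1, h2, h3⟩ c
    by_cases hc : c ∈ P
    · simp [pinnedTargets, hc, h2 c hc]
    · simp only [pinnedTargets, hc, if_false, Finset.mem_filter]
      exact ⟨h1 c, fun p hp hpc => h2 p hp ▸ h3 c hc p hp hpc⟩

open Classical in
/-- Every edge not contained in `P` either avoids `P` or joins `P` to its complement. -/
theorem card_edges_not_subset_eq {W : Type*} [Fintype W] (F : SimpleGraph W) (P : Finset W) :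
    (F.edgeFinset.filter fun e => ∃ a ∈ e, a ∉ P).card =
      (F.edgeFinset.filter fun e => ∀ a ∈ e, a ∉ P).card +
        ∑ c ∈ Pᶜ, (P.filter fun p => F.Adj p c).card := by
  rw [← Finset.card_filter_add_card_filter_not (s := F.edgeFinset.filter fun e => ∃ a ∈ e, a ∉ P)
    fun e => ∀ a ∈ e, a ∉ P]
  congr 1
  · congr 1
    ext e
    simp only [Finset.mem_filter]
    constructor
    · tauto
    · rintro ⟨h, h'⟩
      exact ⟨⟨h, e.out.1, e.out_fst_mem, h' _ e.out_fst_mem⟩, h'⟩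
  · rw [← Finset.card_sigma]
    symm
    refine Finset.card_bij (fun (q : (_ : W) × W) _ => s(q.1, q.2)) ?_ ?_ ?_
    · rintro ⟨c, p⟩ h
      simp only [Finset.mem_sigma, Finset.mem_compl, Finset.mem_filter,
        SimpleGraph.mem_edgeFinset, SimpleGraph.mem_edgeSet, Sym2.mem_iff] at h ⊢
      exact ⟨⟨h.2.2.symm, c, Or.inl rfl, h.1⟩, fun h' => h' p (Or.inr rfl) h.2.1⟩
    · rintro ⟨c, p⟩ h ⟨c', p'⟩ h' heq
      simp only [Finset.mem_sigma, Finset.mem_compl, Finset.mem_filter] at h h'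
      rcases Sym2.eq_iff.1 heq with ⟨h1, h2⟩ | ⟨h1, h2⟩
      · simp only at h1 h2
        rw [h1, h2]
      · simp only at h1
        exact absurd (h1 ▸ h'.2.1) h.1
    · intro e
      induction e using Sym2.ind with
      | _ a b =>
      simp only [Finset.mem_sigma, Finset.mem_compl, Finset.mem_filter,
        SimpleGraph.mem_edgeFinset, SimpleGraph.mem_edgeSet, Sym2.mem_iff]
      rintro ⟨⟨hab, _⟩, h⟩
      by_cases ha : a ∈ P
      · have hb : b ∉ P := by
          rintro hb
          grind
        exact ⟨⟨b, a⟩, ⟨hb, ha, hab⟩, Sym2.eq_swap⟩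
      · have hb : b ∈ P := by
          by_contra hb
          grind
        exact ⟨⟨a, b⟩, ⟨ha, hb, hab.symm⟩, rfl⟩

theorem card_pinnedTargets_le {W V : Type*} [DecidableEq W] {F : SimpleGraph W}
    {G : SimpleGraph V} {T : W → Finset V} {P : Finset W} {τ : W → V} {B : ℝ}
    (hB : ∀ c, ((T c).card : ℝ) ≤ B) (c : W) :
    ((pinnedTargets F G T P τ c).card : ℝ) ≤ if c ∈ P then 1 else B := by
  by_cases hc : c ∈ P
  · simp [pinnedTargets, hc]
  · simp only [pinnedTargets, hc, if_false]
    refine le_trans ?_ (hB c)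
    refine Nat.cast_le.2 (Finset.card_le_card fun z hz => ?_)
    simp only [Finset.mem_filter] at hz
    exact hz.1

theorem mul_prod_erase_pinnedTargets_le {W V : Type*} [Fintype W] [DecidableEq W]
    {F : SimpleGraph W} {G : SimpleGraph V} {T : W → Finset V} {P : Finset W} {τ : W → V} {B : ℝ}
    (hB : ∀ c, ((T c).card : ℝ) ≤ B) {a : W} (ha : a ∉ P) :
    B * ∏ c ∈ Finset.univ.erase a, ((pinnedTargets F G T P τ c).card : ℝ) ≤ B ^ Pᶜ.card := by
  have hB0 : 0 ≤ B := le_trans (Nat.cast_nonneg _) (hB a)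
  have e : B ^ Pᶜ.card = ∏ c, if c ∈ P then 1 else B := by
    rw [Finset.prod_ite]
    simp [Finset.compl_eq_univ_sdiff, Finset.filter_notMem_eq_sdiff]
  rw [e, ← Finset.mul_prod_erase _ _ (Finset.mem_univ a), if_neg ha]
  gcongr with c hc
  exact card_pinnedTargets_le hB c

theorem sq_mul_prod_erase_pinnedTargets_le {W V : Type*} [Fintype W] [DecidableEq W]
    {F : SimpleGraph W} {G : SimpleGraph V} {T : W → Finset V} {P : Finset W} {τ : W → V} {B : ℝ}
    (hB : ∀ c, ((T c).card : ℝ) ≤ B) {a b : W}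
    (hab : a ≠ b) (ha : a ∉ P) (hb : b ∉ P) :
    B ^ 2 * ∏ c ∈ (Finset.univ.erase a).erase b, ((pinnedTargets F G T P τ c).card : ℝ) ≤
      B ^ Pᶜ.card := by
  have hB0 : 0 ≤ B := le_trans (Nat.cast_nonneg _) (hB a)
  have e : B ^ Pᶜ.card = ∏ c, if c ∈ P then 1 else B := by
    rw [Finset.prod_ite]
    simp [Finset.compl_eq_univ_sdiff, Finset.filter_notMem_eq_sdiff]
  rw [e, ← Finset.mul_prod_erase _ _ (Finset.mem_univ a), if_neg ha,
    ← Finset.mul_prod_erase (Finset.univ.erase a) (fun c => if c ∈ P then 1 else B) (a := b)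
      (by simp [hab.symm]), if_neg hb, ← mul_assoc, ← sq]
  gcongr with c hc
  exact card_pinnedTargets_le hB c

open Classical in
theorem abs_card_pinned_homs_sub_le {W V : Type*} [Fintype W] [Nonempty V]
    (F : SimpleGraph W) (G : SimpleGraph V) (T : W → Finset V) (P : Finset W) (τ : W → V)
    (d ζ n : ℝ) (hd : 0 ≤ d) (hd1 : d ≤ 1) (hζ : 0 ≤ ζ) (hn : 0 ≤ n)
    (hT : ∀ c, ((T c).card : ℝ) ≤ 2 * n)
    (hS : ∀ c ∉ P, |((pinnedTargets F G T P τ c).card : ℝ) -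
      d ^ (P.filter fun p => F.Adj p c).card * n| ≤ 3 * ζ * n)
    (hreg : ∀ a b, F.Adj a b → ∀ X ⊆ T a, ∀ Y ⊆ T b,
      |(((X ×ˢ Y).filter fun p => G.Adj p.1 p.2).card : ℝ) - d * (X.card * Y.card)| ≤
        ζ * (2 * n) ^ 2) :
    |(((Fintype.piFinset (pinnedTargets F G T P τ)).filter fun ψ =>
        ∀ e ∈ F.edgeFinset.filter fun e => ∀ a ∈ e, a ∉ P, e.map ψ ∈ G.edgeSet).card : ℝ) -
      d ^ (F.edgeFinset.filter fun e => ∃ a ∈ e, a ∉ P).card * n ^ Pᶜ.card| ≤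
      (F.edgeFinset.card + 2 * Fintype.card W) * (ζ * (2 * n) ^ Pᶜ.card) := by
  have h1 := abs_card_filter_edges_sub_le (pinnedTargets F G T P τ) G
    (F.edgeFinset.filter fun e => ∀ a ∈ e, a ∉ P) d (ζ * (2 * n) ^ 2) (ζ * (2 * n) ^ Pᶜ.card)
    hd hd1 ?_
  · have hprod : ∏ c, ((pinnedTargets F G T P τ c).card : ℝ) =
        ∏ c ∈ Pᶜ, ((pinnedTargets F G T P τ c).card : ℝ) := by
      symm
      refine Finset.prod_subset (Finset.subset_univ _) fun c _ hc => ?_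
      have : c ∈ P := by simpa using hc
      simp [pinnedTargets, this]
    have h2 := abs_prod_sub_prod_le Pᶜ (fun c => ((pinnedTargets F G T P τ c).card : ℝ))
      (fun c => d ^ (P.filter fun p => F.Adj p c).card * n) (2 * n) (2 * ζ) (by positivity)
      (by positivity) (fun c hc => ⟨by positivity, by
        simpa [Finset.mem_compl.1 hc] using card_pinnedTargets_le (F := F) (G := G) (P := P)
          (τ := τ) hT c⟩)
      (fun c _ => ⟨by positivity, by
        have : d ^ (P.filter fun p => F.Adj p c).card ≤ 1 := pow_le_one₀ hd hd1
        nlinarith⟩)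
      (fun c hc => (hS c (Finset.mem_compl.1 hc)).trans (by nlinarith [mul_nonneg hζ hn]))
    rw [Finset.prod_mul_distrib, Finset.prod_const, Finset.prod_pow_eq_pow_sum, ← hprod] at h2
    rw [card_edges_not_subset_eq, pow_add]
    set A := d ^ (F.edgeFinset.filter fun e => ∀ a ∈ e, a ∉ P).card
    have hA0 : 0 ≤ A := by positivity
    have hA1 : A ≤ 1 := pow_le_one₀ hd hd1
    set D := ζ * (2 * n) ^ Pᶜ.card with hD
    have hD0 : 0 ≤ D := by positivity
    have h3 : |A * (∏ c, ((pinnedTargets F G T P τ c).card : ℝ)) -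
        A * (d ^ (∑ c ∈ Pᶜ, (P.filter fun p => F.Adj p c).card) * n ^ Pᶜ.card)| ≤
        2 * Fintype.card W * D := by
      rw [← mul_sub, abs_mul, abs_of_nonneg hA0]
      calc _ ≤ 1 * (Pᶜ.card * (2 * ζ) * (2 * n) ^ Pᶜ.card) := by gcongr
        _ = 2 * (Pᶜ.card : ℝ) * D := by rw [hD]; ring
        _ ≤ _ := by
          gcongr
          exact Finset.card_le_univ _
    have h4 : ((F.edgeFinset.filter fun e => ∀ a ∈ e, a ∉ P).card : ℝ) * D ≤
        F.edgeFinset.card * D := by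
      gcongr
      exact Finset.filter_subset _ _
    rw [mul_assoc]
    refine (abs_sub_le _ _ _).trans ((add_le_add (h1.trans h4) h3).trans_eq (by ring))
  · intro a b hab
    simp only [Finset.mem_filter, SimpleGraph.mem_edgeFinset, SimpleGraph.mem_edgeSet,
      Sym2.mem_iff] at hab
    have ha : a ∉ P := hab.2 a (Or.inl rfl)
    have hb : b ∉ P := hab.2 b (Or.inr rfl)
    refine ⟨hab.1.ne, ?_, fun X hX Y hY => ?_⟩
    · rw [mul_assoc]
      exact mul_le_mul_of_nonneg_left
        (sq_mul_prod_erase_pinnedTargets_le hT hab.1.ne ha hb) hζ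
    · convert hreg a b hab.1 X (hX.trans (pinnedTargets_subset ha)) Y
        (hY.trans (pinnedTargets_subset hb))

/-- An event that restricts one unpinned vertex to few choices is rare. -/
theorem card_filter_pinned_le {W V : Type*} [Fintype W] [DecidableEq W] [Nonempty V]
    {F : SimpleGraph W} {G : SimpleGraph V} {T : W → Finset V} {P : Finset W} {τ : W → V}
    {ζ n : ℝ} (hζ : 0 ≤ ζ) (hn : 0 ≤ n) (hT : ∀ c, ((T c).card : ℝ) ≤ 2 * n)
    {a : W} (ha : a ∉ P) (Q : (W → V) → Prop) [DecidablePred Q]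
    (hQ : ∀ ρ : W → V, (∀ p ∈ P, ρ p = τ p) →
      (((pinnedTargets F G T P τ a).filter fun x => Q (Function.update ρ a x)).card : ℝ) ≤
        ζ * n) :
    (((Fintype.piFinset (pinnedTargets F G T P τ)).filter Q).card : ℝ) ≤
      ζ * (2 * n) ^ Pᶜ.card := by
  refine (card_filter_piFinset_le _ a Q (ζ * n) fun ρ hρ => hQ ρ fun p hp => ?_).trans ?_
  · simpa [pinnedTargets, hp] using hρ p (by rintro rfl; exact ha hp)
  · have := mul_prod_erase_pinnedTargets_le (F := F) (G := G) (P := P) (τ := τ) hT ha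
    have h0 : 0 ≤ ∏ c ∈ Finset.univ.erase a, ((pinnedTargets F G T P τ c).card : ℝ) := by
      positivity
    calc _ = ζ * (n * ∏ c ∈ Finset.univ.erase a, ((pinnedTargets F G T P τ c).card : ℝ)) := by
          ring
      _ ≤ ζ * (2 * n * ∏ c ∈ Finset.univ.erase a, ((pinnedTargets F G T P τ c).card : ℝ)) := by
          gcongr
          linarith
      _ ≤ _ := by gcongr

open Classical in
theorem card_filter_pinned_not_injective_le {W V : Type*} [Fintype W] [Nonempty V]
    {F : SimpleGraph W} {G : SimpleGraph V} {T : W → Finset V} {P : Finset W} {τ : W → V}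
    {ζ n : ℝ} (hζ : 0 ≤ ζ) (hn : 0 ≤ n) (hζn : 1 ≤ ζ * n)
    (hT : ∀ c, ((T c).card : ℝ) ≤ 2 * n) (hτ : ∀ p ∈ P, τ p ∈ T p) (hτi : Set.InjOn τ P)
    (a b : W) :
    (((Fintype.piFinset (pinnedTargets F G T P τ)).filter fun ψ => a ≠ b ∧ ψ a = ψ b).card : ℝ) ≤
      ζ * (2 * n) ^ Pᶜ.card := by
  have hD0 : 0 ≤ ζ * (2 * n) ^ Pᶜ.card := by positivity
  by_cases hab : a = b
  · rw [Finset.filter_false_of_mem fun ψ _ h => h.1 hab, Finset.card_empty, Nat.cast_zero]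
    exact hD0
  have key : ∀ a b, a ≠ b → a ∉ P →
      (((Fintype.piFinset (pinnedTargets F G T P τ)).filter fun ψ => a ≠ b ∧ ψ a = ψ b).card : ℝ) ≤
        ζ * (2 * n) ^ Pᶜ.card := by
    intro a b hab ha
    refine card_filter_pinned_le hζ hn hT ha _ fun ρ _ => le_trans ?_ hζn
    norm_cast
    rw [Finset.card_le_one]
    intro x hx y hy
    simp [hab.symm] at hx hy
    rw [hx.2.2, hy.2.2]
  by_cases ha : a ∈ P
  · by_cases hb : b ∈ P
    · rw [Finset.filter_false_of_mem, Finset.card_empty, Nat.cast_zero]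
      · exact hD0
      · rintro ψ hψ ⟨_, h⟩
        have := ((mem_piFinset_pinnedTargets hτ).1 hψ).2.1
        rw [this a ha, this b hb] at h
        exact hab (hτi ha hb h)
    · have := key b a (Ne.symm hab) hb
      simpa only [ne_comm, eq_comm] using this
  · exact key a b hab ha

open Classical in
theorem card_filter_pinned_same_colour_le {W V : Type*} [Fintype W] [Fintype V] [Nonempty V]
    {F : SimpleGraph W} {G : SimpleGraph V} {φ : Sym2 V → ℕ} {T : W → Finset V} {P : Finset W}
    {τ : W → V} {ζ n : ℝ} (hζ : 0 ≤ ζ) (hn : 0 ≤ n)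
    (hT : ∀ c, ((T c).card : ℝ) ≤ 2 * n)
    (hloc : ∀ x c, ((Finset.univ.filter fun y => G.Adj x y ∧ φ s(x, y) = c).card : ℝ) ≤ ζ * n)
    (hspec : ∀ e₁ ∈ F.edgeSet, ∀ e₂ ∈ F.edgeSet, e₁ ≠ e₂ → (∀ a ∉ P, a ∈ e₁ ↔ a ∈ e₂) →
      ∃ z ∉ P, ∀ ρ : W → V, (∀ p ∈ P, ρ p = τ p) →
        ((Finset.univ.filter fun x => e₁.map (Function.update ρ z x) ∈ G.edgeSet ∧
          e₂.map (Function.update ρ z x) ∈ G.edgeSet ∧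
          φ (e₁.map (Function.update ρ z x)) = φ (e₂.map (Function.update ρ z x))).card : ℝ) ≤
        ζ * n)
    {e₁ e₂ : Sym2 W} (h₁ : e₁ ∈ F.edgeSet) (h₂ : e₂ ∈ F.edgeSet) :
    (((Fintype.piFinset (pinnedTargets F G T P τ)).filter fun ψ => e₁ ≠ e₂ ∧
      e₁.map ψ ∈ G.edgeSet ∧ e₂.map ψ ∈ G.edgeSet ∧ φ (e₁.map ψ) = φ (e₂.map ψ)).card : ℝ) ≤
      ζ * (2 * n) ^ Pᶜ.card := by
  have hD0 : 0 ≤ ζ * (2 * n) ^ Pᶜ.card := by positivity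
  by_cases h12 : e₁ = e₂
  · rw [Finset.filter_false_of_mem fun ψ _ h => h.1 h12, Finset.card_empty, Nat.cast_zero]
    exact hD0
  have key : ∀ a e₁ e₂, e₁ ∈ F.edgeSet → a ∉ P → a ∈ e₁ → a ∉ e₂ →
      (((Fintype.piFinset (pinnedTargets F G T P τ)).filter fun ψ =>
        e₁ ≠ e₂ ∧ e₁.map ψ ∈ G.edgeSet ∧ e₂.map ψ ∈ G.edgeSet ∧
        φ (e₁.map ψ) = φ (e₂.map ψ)).card : ℝ) ≤ ζ * (2 * n) ^ Pᶜ.card := by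
    intro a e₁ e₂ he₁ ha h1 h2
    obtain ⟨b, rfl⟩ := h1
    have hab : a ≠ b := SimpleGraph.Adj.ne he₁
    refine card_filter_pinned_le hζ hn hT ha _ fun ρ _ =>
      le_trans ?_ (hloc (ρ b) (φ (e₂.map ρ)))
    norm_cast
    refine Finset.card_le_card fun x hx => ?_
    have e2 : e₂.map (Function.update ρ a x) = e₂.map ρ := Sym2.map_congr fun c hc => by
      rw [Function.update_of_ne]; rintro rfl; exact h2 hc
    simp only [Finset.mem_filter, e2, Sym2.map_mk, Function.update_self,
      Function.update_of_ne hab.symm, SimpleGraph.mem_edgeSet] at hx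
    simp only [Finset.mem_filter, Finset.mem_univ, true_and]
    exact ⟨hx.2.2.1.symm, Sym2.eq_swap ▸ hx.2.2.2.2⟩
  by_cases hex : ∀ a ∉ P, a ∈ e₁ ↔ a ∈ e₂
  · obtain ⟨z, hz, hb⟩ := hspec e₁ h₁ e₂ h₂ h12 hex
    refine card_filter_pinned_le hζ hn hT hz _ fun ρ hρ => le_trans ?_ (hb ρ hρ)
    norm_cast
    refine Finset.card_le_card fun x hx => ?_
    simp only [Finset.mem_filter, Finset.mem_univ, true_and] at hx ⊢
    exact hx.2.2
  · push Not at hex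
    obtain ⟨a, ha, ⟨h1, h2⟩ | ⟨h1, h2⟩⟩ := hex
    · exact key a e₁ e₂ h₁ ha h1 h2
    · refine le_trans (le_of_eq ?_) (key a e₂ e₁ h₂ ha h2 h1)
      congr 2
      ext ψ
      grind

open Classical in
theorem abs_ncard_pinnedEmbeddings_sub_le {W V : Type*} [Fintype W] [Fintype V] [Nonempty V]
    (F : SimpleGraph W) (G : SimpleGraph V) (φ : Sym2 V → ℕ) (T : W → Finset V) (P : Finset W)
    (τ : W → V) (d ζ n : ℝ) (hd : 0 ≤ d) (hd1 : d ≤ 1) (hζ : 0 ≤ ζ) (hn : 0 ≤ n)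
    (hζn : 1 ≤ ζ * n)
    (hτ : ∀ p ∈ P, τ p ∈ T p) (hτi : Set.InjOn τ P)
    (hτadj : ∀ p ∈ P, ∀ p' ∈ P, F.Adj p p' → G.Adj (τ p) (τ p'))
    (hT : ∀ c, ((T c).card : ℝ) ≤ 2 * n)
    (hS : ∀ c ∉ P, |((pinnedTargets F G T P τ c).card : ℝ) -
      d ^ (P.filter fun p => F.Adj p c).card * n| ≤ 3 * ζ * n)
    (hreg : ∀ a b, F.Adj a b → ∀ X ⊆ T a, ∀ Y ⊆ T b,
      |(((X ×ˢ Y).filter fun p => G.Adj p.1 p.2).card : ℝ) - d * (X.card * Y.card)| ≤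
        ζ * (2 * n) ^ 2)
    (hloc : ∀ x c, ((Finset.univ.filter fun y => G.Adj x y ∧ φ s(x, y) = c).card : ℝ) ≤ ζ * n)
    (hspec : ∀ e₁ ∈ F.edgeSet, ∀ e₂ ∈ F.edgeSet, e₁ ≠ e₂ → (∀ a ∉ P, a ∈ e₁ ↔ a ∈ e₂) →
      ∃ z ∉ P, ∀ ρ : W → V, (∀ p ∈ P, ρ p = τ p) →
        ((Finset.univ.filter fun x => e₁.map (Function.update ρ z x) ∈ G.edgeSet ∧
          e₂.map (Function.update ρ z x) ∈ G.edgeSet ∧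
          φ (e₁.map (Function.update ρ z x)) = φ (e₂.map (Function.update ρ z x))).card : ℝ) ≤
        ζ * n) :
    |((pinnedEmbeddings F G φ T P τ).ncard : ℝ) -
      d ^ (F.edgeFinset.filter fun e => ∃ a ∈ e, a ∉ P).card * n ^ Pᶜ.card| ≤
      (F.edgeFinset.card + 2 * Fintype.card W + Fintype.card W ^ 2 + F.edgeFinset.card ^ 2) *
        (ζ * (2 * n) ^ Pᶜ.card) := by
  have main := abs_card_pinned_homs_sub_le F G T P τ d ζ n hd hd1 hζ hn hT hS hreg
  set Ω := Fintype.piFinset (pinnedTargets F G T P τ) with hΩ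
  set H := Ω.filter fun ψ =>
        ∀ e ∈ F.edgeFinset.filter fun e => ∀ a ∈ e, a ∉ P, e.map ψ ∈ G.edgeSet with hH
  set D := ζ * (2 * n) ^ Pᶜ.card with hD
  have hD0 : 0 ≤ D := by positivity
  have memH : ∀ ψ, ψ ∈ H ↔ (∀ c, ψ c ∈ T c) ∧ (∀ p ∈ P, ψ p = τ p) ∧
      ∀ a b, F.Adj a b → G.Adj (ψ a) (ψ b) := by
    intro ψ
    rw [hH, Finset.mem_filter, hΩ, mem_piFinset_pinnedTargets hτ]
    simp only [Finset.mem_filter, SimpleGraph.mem_edgeFinset]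
    constructor
    · rintro ⟨⟨h1, h2, h3⟩, h4⟩
      refine ⟨h1, h2, fun a b hab => ?_⟩
      by_cases ha : a ∈ P
      · by_cases hb : b ∈ P
        · rw [h2 a ha, h2 b hb]
          exact hτadj a ha b hb hab
        · exact h3 b hb a ha hab
      · by_cases hb : b ∈ P
        · exact (h3 a ha b hb hab.symm).symm
        · have := h4 s(a, b) ⟨hab, by simp [ha, hb]⟩
          simpa using this
    · rintro ⟨h1, h2, h3⟩
      refine ⟨⟨h1, h2, fun c _ p _ => h3 p c⟩, fun e he => ?_⟩
      induction e using Sym2.ind with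
      | _ a b => simpa using h3 a b he.1
  have hsub : (H.filter fun ψ => Function.Injective ψ ∧
      Set.InjOn φ (Sym2.map ψ '' F.edgeSet)).card = (pinnedEmbeddings F G φ T P τ).ncard := by
    rw [← Set.ncard_coe_finset]
    congr 1
    ext ψ
    simp only [Finset.coe_filter, memH, pinnedEmbeddings, Set.mem_ofPred_eq]
    tauto
  have hpair : ∀ q : W × W, ((Ω.filter fun ψ => q.1 ≠ q.2 ∧ ψ q.1 = ψ q.2).card : ℝ) ≤ D :=
    fun q => card_filter_pinned_not_injective_le hζ hn hζn hT hτ hτi q.1 q.2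
  have hcol : ∀ q ∈ F.edgeFinset ×ˢ F.edgeFinset, ((Ω.filter fun ψ => q.1 ≠ q.2 ∧
      q.1.map ψ ∈ G.edgeSet ∧ q.2.map ψ ∈ G.edgeSet ∧
      φ (q.1.map ψ) = φ (q.2.map ψ)).card : ℝ) ≤ D := by
    intro q hq
    simp only [Finset.mem_product, SimpleGraph.mem_edgeFinset] at hq
    exact card_filter_pinned_same_colour_le hζ hn hT hloc hspec hq.1 hq.2
  have hbad : ((H.filter fun ψ => ¬ (Function.Injective ψ ∧
      Set.InjOn φ (Sym2.map ψ '' F.edgeSet))).card : ℝ) ≤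
      (Fintype.card W ^ 2 + F.edgeFinset.card ^ 2) * D := by
    have hcov : (H.filter fun ψ => ¬ (Function.Injective ψ ∧
      Set.InjOn φ (Sym2.map ψ '' F.edgeSet))) ⊆
      ((Finset.univ : Finset (W × W)).biUnion fun q =>
        Ω.filter fun ψ => q.1 ≠ q.2 ∧ ψ q.1 = ψ q.2) ∪
      ((F.edgeFinset ×ˢ F.edgeFinset).biUnion fun q => Ω.filter fun ψ => q.1 ≠ q.2 ∧
        q.1.map ψ ∈ G.edgeSet ∧ q.2.map ψ ∈ G.edgeSet ∧ φ (q.1.map ψ) = φ (q.2.map ψ)) := by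
      intro ψ hψ
      obtain ⟨hψH, hψ⟩ := Finset.mem_filter.1 hψ
      have hψΩ : ψ ∈ Ω := (Finset.mem_filter.1 hψH).1
      have hadj := ((memH ψ).1 hψH).2.2
      have hmap : ∀ e ∈ F.edgeSet, e.map ψ ∈ G.edgeSet := by
        intro e he
        induction e using Sym2.ind with
        | _ a b => simpa using hadj a b he
      rw [Finset.mem_union, Finset.mem_biUnion, Finset.mem_biUnion]
      by_cases hinj : Function.Injective ψ
      · right
        have : ¬ Set.InjOn φ (Sym2.map ψ '' F.edgeSet) := fun h => hψ ⟨hinj, h⟩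
        simp only [Set.InjOn] at this
        push Not at this
        obtain ⟨_, ⟨e₁, h1, rfl⟩, _, ⟨e₂, h2, rfl⟩, hc, hne⟩ := this
        refine ⟨(e₁, e₂), by simp [h1, h2], Finset.mem_filter.2 ⟨hψΩ, ?_, hmap _ h1, hmap _ h2, hc⟩⟩
        exact fun h => hne (congrArg (Sym2.map ψ) h)
      · left
        simp only [Function.Injective] at hinj
        push Not at hinj
        obtain ⟨a, b, h, hne⟩ := hinj
        exact ⟨(a, b), Finset.mem_univ _, Finset.mem_filter.2 ⟨hψΩ, hne, h⟩⟩
    refine (Nat.cast_le.2 ((Finset.card_le_card hcov).trans (Finset.card_union_le _ _))).trans ?_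
    rw [Nat.cast_add, add_mul]
    refine add_le_add ?_ ?_
    · refine (Nat.cast_le.2 Finset.card_biUnion_le).trans ?_
      rw [Nat.cast_sum]
      refine (Finset.sum_le_sum fun q _ => hpair q).trans_eq ?_
      simp [sq]
    · refine (Nat.cast_le.2 Finset.card_biUnion_le).trans ?_
      rw [Nat.cast_sum]
      refine (Finset.sum_le_sum hcol).trans_eq ?_
      simp [sq]
  have hsplit := Finset.card_filter_add_card_filter_not (s := H) fun ψ => Function.Injective ψ ∧
      Set.InjOn φ (Sym2.map ψ '' F.edgeSet)
  rw [hsub] at hsplit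
  have hsplit' : ((pinnedEmbeddings F G φ T P τ).ncard : ℝ) + ((H.filter fun ψ =>
    ¬ (Function.Injective ψ ∧ Set.InjOn φ (Sym2.map ψ '' F.edgeSet))).card : ℝ) = H.card := by
    exact_mod_cast hsplit
  have h0 : (0 : ℝ) ≤ ((H.filter fun ψ =>
    ¬ (Function.Injective ψ ∧ Set.InjOn φ (Sym2.map ψ '' F.edgeSet))).card : ℝ) := by positivity
  rw [abs_le] at main ⊢
  constructor <;> nlinarith

theorem exists_iso_of_toSubgraph_eq {V W : Type*} {F : SimpleGraph W} {G : SimpleGraph V}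
    (c : SimpleGraph.Copy F G) {H : G.Subgraph} (h : c.toSubgraph = H) :
    ∃ e : F ≃g H.coe, ∀ x, ((e x : H.verts) : V) = c x := by
  subst h
  exact ⟨c.isoToSubgraph, fun x => rfl⟩

theorem exists_copy_of_iso {V W : Type*} {F : SimpleGraph W} {G : SimpleGraph V}
    {H : G.Subgraph} (e : F ≃g H.coe) :
    ∃ c : SimpleGraph.Copy F G, c.toSubgraph = H ∧ ∀ x, c x = ((e x : H.verts) : V) := by
  refine ⟨⟨H.hom.comp e.toHom, SimpleGraph.Subgraph.hom_injective.comp e.injective⟩, ?_,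
    fun x => rfl⟩
  simp [SimpleGraph.Copy.toSubgraph, SimpleGraph.Subgraph.map_comp]

instance {V W : Type*} [Finite V] [Finite W] {F : SimpleGraph W} {G : SimpleGraph V} :
    Finite (SimpleGraph.Copy F G) :=
  Finite.of_injective (fun c => (c : W → V)) DFunLike.coe_injective

/-- The isomorphisms from `F` to a fixed copy that respect the partitions form a torsor under
the automorphisms of `F` preserving the partition. -/
theorem card_respecting_iso {V W : Type*} [Finite W] {r : ℕ} {F : SimpleGraph W}
    {𝒳 : Fin r → Set W} {G : SimpleGraph V} {𝒱 : Fin r → Set V}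
    (h𝒳 : ∀ x, ∃! i, x ∈ 𝒳 i) (hne : ∀ i, (𝒳 i).Nonempty) (h𝒱 : ∀ x, ∃! i, x ∈ 𝒱 i)
    {H : G.Subgraph} (e₀ : F ≃g H.coe) {π₀ : Fin r → Fin r} (hπ₀ : Function.Injective π₀)
    (he₀ : ∀ i, ∀ x ∈ 𝒳 i, ((e₀ x : H.verts) : V) ∈ 𝒱 (π₀ i)) :
    Nat.card {e : F ≃g H.coe // ∃ π : Fin r → Fin r, Function.Injective π ∧
      ∀ i, ∀ x ∈ 𝒳 i, ((e x : H.verts) : V) ∈ 𝒱 (π i)} = autXCard F 𝒳 := by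
  symm
  refine Nat.card_congr (Equiv.subtypeEquiv
    ⟨fun σ => σ.trans e₀, fun e => e.trans e₀.symm, fun σ => ?_, fun e => ?_⟩ fun σ => ?_)
  · ext x; simp
  · ext x; simp
  · simp only [Equiv.coe_fn_mk]
    constructor
    · rintro ⟨h1, h2⟩
      choose s hs using h1
      have hsurj : Function.Surjective s := by
        intro j
        obtain ⟨i, hi⟩ := h2 j
        obtain ⟨x, hx⟩ := hne j
        exact ⟨i, (h𝒳 x).unique (by rw [← hs, hi]; exact hx) hx⟩
      refine ⟨π₀ ∘ s, hπ₀.comp (Finite.injective_iff_surjective.2 hsurj), fun i x hx => ?_⟩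
      exact he₀ (s i) (σ x) (by rw [← hs]; exact ⟨x, hx, rfl⟩)
    · rintro ⟨π, hπ, h⟩
      have hb := Finite.injective_iff_surjective.1 hπ
      have hb₀ := Finite.injective_iff_surjective.1 hπ₀
      have key : ∀ i j, π i = π₀ j → (fun x => σ x) '' 𝒳 i = 𝒳 j := by
        intro i j hij
        ext y
        constructor
        · rintro ⟨x, hx, rfl⟩
          obtain ⟨k, hk, -⟩ := h𝒳 (σ x)
          have h1 := he₀ k _ hk
          have h2 := h i x hx
          have : π i = π₀ k := (h𝒱 _).unique h2 h1
          rw [hij] at this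
          exact hπ₀ this ▸ hk
        · intro hy
          refine ⟨σ.symm y, ?_, by simp⟩
          obtain ⟨k, hk, -⟩ := h𝒳 (σ.symm y)
          have h1 := he₀ j _ hy
          have h2 := h k _ hk
          have h2' : ((e₀ y : H.verts) : V) ∈ 𝒱 (π k) := by simpa using h2
          have : π k = π i := hij ▸ (h𝒱 _).unique h2' h1
          exact hπ this ▸ hk
      refine ⟨fun i => ?_, fun j => ?_⟩
      · obtain ⟨j, hj⟩ := hb₀ (π i)
        exact ⟨j, key i j hj.symm⟩
      · obtain ⟨i, hi⟩ := hb (π₀ j)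
        exact ⟨i, key i j hi⟩

theorem rCount_mul_autXCard {V W : Type*} [Finite V] [Finite W] {r : ℕ} {F : SimpleGraph W}
    {𝒳 : Fin r → Set W} {G : SimpleGraph V} {𝒱 : Fin r → Set V} {φ : Sym2 V → ℕ}
    (P : G.Subgraph → Prop)
    (h𝒳 : ∀ x, ∃! i, x ∈ 𝒳 i) (hne : ∀ i, (𝒳 i).Nonempty) (h𝒱 : ∀ x, ∃! i, x ∈ 𝒱 i) :
    rCount F 𝒳 G 𝒱 φ P * autXCard F 𝒳 =
      {c : SimpleGraph.Copy F G | Rainbow φ c.toSubgraph.edgeSet ∧ P c.toSubgraph ∧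
        ∃ π : Fin r → Fin r, Function.Injective π ∧ ∀ i, ∀ x ∈ 𝒳 i, c x ∈ 𝒱 (π i)}.ncard := by
  classical
  have := Fintype.ofFinite (SimpleGraph.Copy F G)
  have := Fintype.ofFinite G.Subgraph
  rw [rCount, Set.ncard_eq_toFinset_card', Set.ncard_eq_toFinset_card',
    Finset.card_eq_sum_card_fiberwise (f := fun c : SimpleGraph.Copy F G => c.toSubgraph)
      (t := Set.toFinset {H : G.Subgraph | Rainbow φ H.edgeSet ∧ P H ∧
      ∃ (e : F ≃g H.coe) (π : Fin r → Fin r), Function.Injective π ∧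
        ∀ i, ∀ x ∈ 𝒳 i, ((e x : H.verts) : V) ∈ 𝒱 (π i)})]
  · symm
    refine Finset.sum_const_nat fun H hH => ?_
    rw [Set.mem_toFinset] at hH
    obtain ⟨h1, h2, e₀, π₀, hπ₀, he₀⟩ := hH
    rw [← card_respecting_iso h𝒳 hne h𝒱 e₀ hπ₀ he₀, ← Fintype.card_coe, ← Nat.card_eq_fintype_card]
    symm
    choose c hc hcx using fun e : F ≃g H.coe => exists_copy_of_iso e
    refine Nat.card_congr (Equiv.ofBijective (fun e => ⟨c e.1, ?_⟩) ⟨?_, ?_⟩)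
    · obtain ⟨e, π, hπ, h⟩ := e
      simp only [Finset.mem_filter, Set.mem_toFinset, Set.mem_ofPred_eq, hc, hcx]
      exact ⟨⟨h1, h2, π, hπ, h⟩, trivial⟩
    · rintro ⟨e, he⟩ ⟨e', he'⟩ h
      simp only [Subtype.mk.injEq] at h ⊢
      ext x
      rw [← hcx, ← hcx, h]
    · rintro ⟨b, hb⟩
      simp only [Finset.mem_filter, Set.mem_toFinset, Set.mem_ofPred_eq] at hb
      obtain ⟨⟨_, _, π, hπ, h⟩, rfl⟩ := hb
      obtain ⟨e, he⟩ := exists_iso_of_toSubgraph_eq b rfl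
      refine ⟨⟨e, π, hπ, fun i x hx => he x ▸ h i x hx⟩, ?_⟩
      simp only [Subtype.mk.injEq]
      ext x
      rw [hcx, he]
  · intro b hb
    simp only [Set.coe_toFinset, Set.mem_ofPred_eq] at hb ⊢
    obtain ⟨h1, h2, π, hπ, h⟩ := hb
    obtain ⟨e, he⟩ := exists_iso_of_toSubgraph_eq b rfl
    exact ⟨h1, h2, e, π, hπ, fun i x hx => he x ▸ h i x hx⟩

theorem ncard_eq_sum_of_image_eq_iUnion {α β ι : Type*} [Finite β] {A : Set α} {f : α → β}
    (hf : Function.Injective f) (I : Finset ι) (B : ι → Set β)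
    (hmem : ∀ a ∈ A, ∃ i ∈ I, f a ∈ B i) (hB : ∀ i ∈ I, ∀ b ∈ B i, ∃ a ∈ A, f a = b)
    (hdisj : ∀ i ∈ I, ∀ j ∈ I, ∀ b, b ∈ B i → b ∈ B j → i = j) :
    A.ncard = ∑ i ∈ I, (B i).ncard := by
  classical
  have := Fintype.ofFinite β
  rw [← Set.ncard_image_of_injective A hf]
  have e : f '' A = ↑(I.biUnion fun i => (B i).toFinset) := by
    ext b
    simp only [Set.mem_image, Finset.coe_biUnion, Set.coe_toFinset, Set.mem_iUnion, Finset.mem_coe]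
    constructor
    · rintro ⟨a, ha, rfl⟩
      obtain ⟨i, hi, h⟩ := hmem a ha
      exact ⟨i, hi, h⟩
    · rintro ⟨i, hi, h⟩
      exact hB i hi b h
  rw [e, Set.ncard_coe_finset, Finset.card_biUnion]
  · exact Finset.sum_congr rfl fun i _ => (Set.ncard_eq_toFinset_card' _).symm
  · intro i hi j hj hij
    rw [Function.onFun, Finset.disjoint_left]
    intro b h1 h2
    exact hij (hdisj i hi j hj b (by simpa using h1) (by simpa using h2))

theorem edgeSet_toSubgraph {V W : Type*} {F : SimpleGraph W} {G : SimpleGraph V}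
    (c : SimpleGraph.Copy F G) : c.toSubgraph.edgeSet = Sym2.map c '' F.edgeSet := by
  rw [SimpleGraph.Copy.toSubgraph, SimpleGraph.Subgraph.edgeSet_map,
    SimpleGraph.Subgraph.edgeSet_top]
  rfl

open Classical in
/-- Rainbow copies satisfying `Q` are counted by the way the partition classes are permuted
and by the placement `k` of the pinned vertices that witnesses `Q`. -/
theorem ncard_copies_eq_sum {V W κ : Type*} [Fintype V] [Finite W] [Fintype κ] {r : ℕ}
    {F : SimpleGraph W} {𝒳 : Fin r → Set W} {G : SimpleGraph V} {𝒱 : Fin r → Set V}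
    {φ : Sym2 V → ℕ} (Q : G.Subgraph → Prop) (p : W → Fin r) (hp : ∀ x i, x ∈ 𝒳 i ↔ p x = i)
    (hne : ∀ i, (𝒳 i).Nonempty) (h𝒱 : ∀ x, ∃! i, x ∈ 𝒱 i) (P : κ → Finset W) (τ : κ → W → V)
    (hQ : ∀ c : SimpleGraph.Copy F G, Q c.toSubgraph ↔ ∃ k, ∀ x ∈ P k, c x = τ k x)
    (huniq : ∀ ψ : W → V, Function.Injective ψ → ∀ k k', (∀ x ∈ P k, ψ x = τ k x) →
      (∀ x ∈ P k', ψ x = τ k' x) → k = k') :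
    {c : SimpleGraph.Copy F G | Rainbow φ c.toSubgraph.edgeSet ∧ Q c.toSubgraph ∧
        ∃ π : Fin r → Fin r, Function.Injective π ∧ ∀ i, ∀ x ∈ 𝒳 i, c x ∈ 𝒱 (π i)}.ncard =
      ∑ q : Equiv.Perm (Fin r) × κ with ∀ x ∈ P q.2, τ q.2 x ∈ 𝒱 (q.1 (p x)),
        (pinnedEmbeddings F G φ (fun x => (𝒱 (q.1 (p x))).toFinset) (P q.2) (τ q.2)).ncard := by
  refine ncard_eq_sum_of_image_eq_iUnion (f := fun c : SimpleGraph.Copy F G => (c : W → V))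
    DFunLike.coe_injective _ _ ?_ ?_ ?_
  · rintro c ⟨h1, h2, π, hπ, h⟩
    obtain ⟨k, hk⟩ := (hQ c).1 h2
    have hc : ∀ x, c x ∈ 𝒱 (π (p x)) := fun x => h (p x) x ((hp x _).2 rfl)
    refine ⟨(Equiv.ofBijective π ⟨hπ, Finite.injective_iff_surjective.1 hπ⟩, k), ?_,
      ?_, hk, c.injective, fun a b hab => c.toHom.map_adj hab, ?_⟩
    · rw [Finset.mem_filter]
      exact ⟨Finset.mem_univ _, fun x hx => hk x hx ▸ hc x⟩
    · intro x
      exact Set.mem_toFinset.2 (hc x)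
    · rw [← edgeSet_toSubgraph]
      exact h1
  · rintro ⟨π, k⟩ _ ψ ⟨h1, h2, h3, h4, h5⟩
    refine ⟨⟨⟨ψ, fun {a b} hab => h4 a b hab⟩, h3⟩, ⟨?_, (hQ _).2 ⟨k, h2⟩, π, π.injective, ?_⟩, rfl⟩
    · rw [edgeSet_toSubgraph]
      exact h5
    · intro i x hx
      have := Set.mem_toFinset.1 (h1 x)
      rw [(hp x i).1 hx] at this
      exact this
  · rintro ⟨π, k⟩ _ ⟨π', k'⟩ _ ψ ⟨h1, h2, h3, _⟩ ⟨h1', h2', _⟩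
    refine Prod.ext (Equiv.ext fun i => ?_) (huniq ψ h3 k k' h2 h2')
    obtain ⟨x, hx⟩ := hne i
    have e1 := Set.mem_toFinset.1 (h1 x)
    have e2 := Set.mem_toFinset.1 (h1' x)
    rw [(hp x i).1 hx] at e1 e2
    exact (h𝒱 _).unique e1 e2

open Classical in
theorem ncard_edgesBetween {V : Type*} (G : SimpleGraph V) (X Y : Finset V)
    (h : Disjoint X Y) :
    (edgesBetween G ↑X ↑Y).ncard = ((X ×ˢ Y).filter fun p => G.Adj p.1 p.2).card := by
  have e : edgesBetween G ↑X ↑Y =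
      (fun p : V × V => s(p.1, p.2)) '' ↑((X ×ˢ Y).filter fun p => G.Adj p.1 p.2) := by
    ext e
    simp only [edgesBetween, Set.mem_ofPred_eq, Set.mem_image, Finset.mem_coe, Finset.mem_filter,
      Finset.mem_product, Prod.exists]
    constructor
    · rintro ⟨he, u, v, rfl, hu, hv⟩
      exact ⟨u, v, ⟨⟨hu, hv⟩, he⟩, rfl⟩
    · rintro ⟨u, v, ⟨⟨hu, hv⟩, he⟩, rfl⟩
      exact ⟨he, u, v, rfl, hu, hv⟩
  rw [e, Set.InjOn.ncard_image, Set.ncard_coe_finset]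
  rintro ⟨a, b⟩ h1 ⟨a', b'⟩ h2 heq
  simp only [Finset.mem_coe, Finset.mem_filter, Finset.mem_product] at h1 h2
  rcases Sym2.eq_iff.1 heq with ⟨h3, h4⟩ | ⟨h3, h4⟩
  · exact Prod.ext h3 h4
  · simp only at h3
    exact absurd (h3 ▸ h1.1.1) (Finset.disjoint_right.1 h h2.1.2)

open Classical in
/-- Regularity bounds the edge discrepancy of all pairs of subsets. -/
theorem RegularPair.abs_card_sub_le {V : Type*} {G : SimpleGraph V} {A B : Finset V}
    {ζ d : ℝ} (hd : 0 ≤ d) (hd1 : d ≤ 1) (hAB : Disjoint A B) (h : RegularPair G ↑A ↑B ζ d)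
    (hζ : 0 ≤ ζ) {X Y : Finset V} (hX : X ⊆ A) (hY : Y ⊆ B) :
    |(((X ×ˢ Y).filter fun p => G.Adj p.1 p.2).card : ℝ) - d * (X.card * Y.card)| ≤
      ζ * (A.card * B.card) := by
  set e := (((X ×ˢ Y).filter fun p => G.Adj p.1 p.2).card : ℝ) with he
  have he0 : 0 ≤ e := by positivity
  have he1 : e ≤ X.card * Y.card := by
    rw [he, ← Nat.cast_mul, ← Finset.card_product]
    exact Nat.cast_le.2 (Finset.card_filter_le _ _)
  have hxA : (X.card : ℝ) ≤ A.card := by exact_mod_cast Finset.card_le_card hX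
  have hyB : (Y.card : ℝ) ≤ B.card := by exact_mod_cast Finset.card_le_card hY
  have hx0 : (0 : ℝ) ≤ X.card := by positivity
  have hy0 : (0 : ℝ) ≤ Y.card := by positivity
  have hxy0 : (0 : ℝ) ≤ X.card * Y.card := by positivity
  have htriv : |e - d * (X.card * Y.card)| ≤ X.card * Y.card := by
    rw [abs_le]
    constructor <;> nlinarith
  by_cases h1 : ζ * A.card ≤ X.card
  · by_cases h2 : ζ * B.card ≤ Y.card
    · rcases hxy0.eq_or_lt with h0 | h0
      · refine htriv.trans ?_
        rw [← h0]
        positivity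
      · have := h ↑X (by exact_mod_cast hX) ↑Y (by exact_mod_cast hY)
          (by simpa [Set.ncard_coe_finset] using h1) (by simpa [Set.ncard_coe_finset] using h2)
        rw [ncard_edgesBetween G X Y (Finset.disjoint_of_subset_left hX
          (Finset.disjoint_of_subset_right hY hAB)), Set.ncard_coe_finset, Set.ncard_coe_finset,
          ← he] at this
        calc |e - d * (X.card * Y.card)|
            = |e / (X.card * Y.card) - d| * (X.card * Y.card) := by
              rw [← abs_of_pos h0, ← abs_mul, abs_of_pos h0, sub_mul, div_mul_cancel₀ _ h0.ne']
          _ ≤ ζ * (X.card * Y.card) := by gcongr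
          _ ≤ _ := by gcongr
    · refine htriv.trans ?_
      push Not at h2
      calc (X.card : ℝ) * Y.card ≤ A.card * (ζ * B.card) := by gcongr
        _ = _ := by ring
  · refine htriv.trans ?_
    push Not at h1
    calc (X.card : ℝ) * Y.card ≤ (ζ * A.card) * B.card := by gcongr
      _ = _ := by ring

theorem card_perm_two_points {α : Type*} [Fintype α] [DecidableEq α] {a b i j : α} (hab : a ≠ b)
    (hij : i ≠ j) :
    (Fintype.card α * (Fintype.card α - 1)) *
      (Finset.univ.filter fun π : Equiv.Perm α => π a = i ∧ π b = j).card =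
      (Fintype.card α).factorial := by
  have hsum := Finset.card_eq_sum_card_fiberwise (s := (Finset.univ : Finset (Equiv.Perm α)))
    (f := fun π => (π a, π b)) (t := (Finset.univ : Finset α).offDiag)
    (fun π _ => by simp [hab])
  rw [Finset.card_univ, Fintype.card_perm] at hsum
  rw [hsum, Finset.sum_const_nat (m :=
    (Finset.univ.filter fun π : Equiv.Perm α => π a = i ∧ π b = j).card), Finset.offDiag_card]
  · rw [Finset.card_univ, Nat.mul_sub, mul_one]
  · rintro ⟨k, l⟩ hkl
    simp only [Finset.mem_offDiag, Finset.mem_univ, true_and] at hkl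
    obtain ⟨σ, hσi, hσj⟩ : ∃ σ : Equiv.Perm α, σ i = k ∧ σ j = l := by
      refine ⟨Equiv.swap (Equiv.swap i k j) l * Equiv.swap i k, ?_, ?_⟩
      · rw [Equiv.Perm.mul_apply, Equiv.swap_apply_left, Equiv.swap_apply_of_ne_of_ne]
        · intro h
          have : Equiv.swap i k i = Equiv.swap i k j := by rw [Equiv.swap_apply_left]; exact h
          exact hij ((Equiv.swap i k).injective this)
        · exact hkl
      · rw [Equiv.Perm.mul_apply, Equiv.swap_apply_left]
    symm
    refine Finset.card_bij (fun π _ => σ * π) ?_ ?_ ?_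
    · intro π hπ
      simp only [Finset.mem_filter, Finset.mem_univ, true_and] at hπ
      simp [hπ, hσi, hσj]
    · intro π _ π' _ h
      exact mul_left_cancel h
    · intro π hπ
      simp only [Finset.mem_filter, Finset.mem_univ, true_and, Prod.mk.injEq] at hπ
      refine ⟨σ⁻¹ * π, ?_, by simp⟩
      simp [hπ, ← hσi, ← hσj]

theorem exists_eq_of_edges_agree_off_pair {W : Type*} {F : SimpleGraph W} {x y : W}
    {e₁ e₂ : Sym2 W} (h₁ : e₁ ∈ F.edgeSet) (h₂ : e₂ ∈ F.edgeSet) (hne : e₁ ≠ e₂)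
    (h : ∀ a, a ≠ x → a ≠ y → (a ∈ e₁ ↔ a ∈ e₂)) :
    ∃ z, z ≠ x ∧ z ≠ y ∧ (e₁ = s(x, z) ∧ e₂ = s(y, z) ∨ e₁ = s(y, z) ∧ e₂ = s(x, z)) := by
  induction e₁ using Sym2.ind with
  | _ a b =>
  induction e₂ using Sym2.ind with
  | _ c d =>
  have hab : a ≠ b := SimpleGraph.Adj.ne h₁
  have hcd : c ≠ d := SimpleGraph.Adj.ne h₂
  simp only [Sym2.mem_iff, Sym2.eq_iff, ne_eq] at *
  have ha := h a
  have hb := h b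
  have hc := h c
  have hd := h d
  clear h h₁ h₂
  by_cases hax : a = x ∨ a = y
  · refine ⟨b, ?_⟩
    by_cases hcx : c = x ∨ c = y <;> by_cases hbx : b = x ∨ b = y <;>
      by_cases hdx : d = x ∨ d = y <;> grind
  · refine ⟨a, ?_⟩
    by_cases hcx : c = x ∨ c = y <;> by_cases hbx : b = x ∨ b = y <;>
      by_cases hdx : d = x ∨ d = y <;> grind

theorem autXCard_pos {W : Type*} [Finite W] {r : ℕ} (F : SimpleGraph W) (𝒳 : Fin r → Set W) :
    0 < autXCard F 𝒳 := by
  have : Finite (F ≃g F) := Finite.of_injective (fun e => (e : W → W)) DFunLike.coe_injective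
  have : Nonempty {π : F ≃g F //
      (∀ i, ∃ j, (fun x => π x) '' 𝒳 i = 𝒳 j) ∧ ∀ j, ∃ i, (fun x => π x) '' 𝒳 i = 𝒳 j} :=
    ⟨⟨SimpleGraph.Iso.refl, fun i => ⟨i, by simp⟩, fun i => ⟨i, by simp⟩⟩⟩
  exact Nat.card_pos

open Classical in
/-- If every family of embeddings with a fixed placement of the classes and of the pinned
vertices has about `B` members, then `rCount` is about `B` times the number of placements. -/
theorem abs_rCount_sub_le {V W κ : Type*} [Fintype V] [Finite W] [Fintype κ] {r : ℕ}
    {F : SimpleGraph W} {𝒳 : Fin r → Set W} {G : SimpleGraph V} {𝒱 : Fin r → Set V}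
    {φ : Sym2 V → ℕ} (Q : G.Subgraph → Prop) (p : W → Fin r) (hp : ∀ x i, x ∈ 𝒳 i ↔ p x = i)
    (hne : ∀ i, (𝒳 i).Nonempty) (h𝒱 : ∀ x, ∃! i, x ∈ 𝒱 i) (P : κ → Finset W) (τ : κ → W → V)
    (hQ : ∀ c : SimpleGraph.Copy F G, Q c.toSubgraph ↔ ∃ k, ∀ x ∈ P k, c x = τ k x)
    (huniq : ∀ ψ : W → V, Function.Injective ψ → ∀ k k', (∀ x ∈ P k, ψ x = τ k x) →
      (∀ x ∈ P k', ψ x = τ k' x) → k = k') (B ε : ℝ)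
    (hB : ∀ (π : Equiv.Perm (Fin r)) (k : κ), (∀ x ∈ P k, τ k x ∈ 𝒱 (π (p x))) →
      |((pinnedEmbeddings F G φ (fun x => (𝒱 (π (p x))).toFinset) (P k) (τ k)).ncard : ℝ) - B| ≤
        ε * B) :
    |(rCount F 𝒳 G 𝒱 φ Q : ℝ) -
      (Finset.univ.filter fun q : Equiv.Perm (Fin r) × κ =>
        ∀ x ∈ P q.2, τ q.2 x ∈ 𝒱 (q.1 (p x))).card * B / autXCard F 𝒳| ≤
    ε * ((Finset.univ.filter fun q : Equiv.Perm (Fin r) × κ =>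
        ∀ x ∈ P q.2, τ q.2 x ∈ 𝒱 (q.1 (p x))).card * B / autXCard F 𝒳) := by
  set I := Finset.univ.filter fun q : Equiv.Perm (Fin r) × κ =>
        ∀ x ∈ P q.2, τ q.2 x ∈ 𝒱 (q.1 (p x)) with hI
  have h𝒳 : ∀ x, ∃! i, x ∈ 𝒳 i := fun x =>
    ⟨p x, (hp x _).2 rfl, fun i hi => ((hp x i).1 hi).symm⟩
  have ha : (0 : ℝ) < autXCard F 𝒳 := by exact_mod_cast autXCard_pos F 𝒳
  have h1 := rCount_mul_autXCard (φ := φ) (F := F) Q h𝒳 hne h𝒱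
  rw [ncard_copies_eq_sum Q p hp hne h𝒱 P τ hQ huniq, ← hI] at h1
  have h2 : (rCount F 𝒳 G 𝒱 φ Q : ℝ) = (∑ q ∈ I, ((pinnedEmbeddings F G φ
      (fun x => (𝒱 (q.1 (p x))).toFinset) (P q.2) (τ q.2)).ncard : ℝ)) / autXCard F 𝒳 := by
    rw [eq_div_iff ha.ne']
    exact_mod_cast h1
  rw [h2, ← sub_div, abs_div, abs_of_pos ha, ← mul_div_assoc]
  refine div_le_div_of_nonneg_right ?_ ha.le
  rw [← nsmul_eq_mul, ← Finset.sum_const, ← Finset.sum_sub_distrib, Finset.mul_sum]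
  refine (Finset.abs_sum_le_sum_abs _ _).trans (Finset.sum_le_sum fun q hq => ?_)
  exact hB q.1 q.2 (Finset.mem_filter.1 hq).2

theorem abs_sub_mul_le_of_abs_sub_le {X a v n ζ : ℝ} (ha : 0 ≤ a) (ha1 : a ≤ 1) (hζ : 0 ≤ ζ)
    (hv : |v - n| ≤ ζ * n) (hv2 : v ≤ 2 * n) (hX : |X - a * v| ≤ ζ * v) :
    |X - a * n| ≤ 3 * ζ * n := by
  have h1 : |a * v - a * n| ≤ ζ * n := by
    rw [← mul_sub, abs_mul, abs_of_nonneg ha]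
    exact (mul_le_of_le_one_left (abs_nonneg _) ha1).trans hv
  have h2 : ζ * v ≤ ζ * (2 * n) := by gcongr
  have := abs_sub_le X (a * v) (a * n)
  linarith

open Classical in
/-- Counting rainbow embeddings into superregular pairs with some vertices pinned. -/
theorem abs_ncard_pinnedEmbeddings_sub_le_of_superregular {V W : Type*} [Fintype V] [Fintype W]
    [Nonempty V] {r : ℕ} {F : SimpleGraph W} {G : SimpleGraph V} {𝒱 : Fin r → Set V}
    {φ : Sym2 V → ℕ} {d ζ n ε : ℝ} (hd : 0 < d) (hd1 : d ≤ 1) (hζ : 0 ≤ ζ) (hζ1 : ζ ≤ 1)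
    (hn : 0 ≤ n) (hζn : 1 ≤ ζ * n)
    (hε : (F.edgeFinset.card + 2 * Fintype.card W + Fintype.card W ^ 2 + F.edgeFinset.card ^ 2) *
      2 ^ Fintype.card W * ζ ≤ ε * d ^ F.edgeFinset.card)
    (h𝒱 : ∀ x, ∃! i, x ∈ 𝒱 i) (hφ : LBounded G φ (ζ * n))
    (hcard : ∀ i, |((𝒱 i).ncard : ℝ) - n| ≤ ζ * n)
    (hreg : ∀ i j, i ≠ j → SuperregularPair G (𝒱 i) (𝒱 j) ζ d)
    {q : W → Fin r} (hq : ∀ a b, F.Adj a b → q a ≠ q b) (P : Finset W) (τ : W → V)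
    (hτ : ∀ p ∈ P, τ p ∈ 𝒱 (q p)) (hτi : Set.InjOn τ P)
    (hτadj : ∀ p ∈ P, ∀ p' ∈ P, F.Adj p p' → G.Adj (τ p) (τ p'))
    (hS : ∀ c ∉ P, |((𝒱 (q c) ∩ {z | ∀ p ∈ P, F.Adj p c → G.Adj (τ p) z}).ncard : ℝ) -
      d ^ (P.filter fun p => F.Adj p c).card * (𝒱 (q c)).ncard| ≤ ζ * (𝒱 (q c)).ncard)
    (hspec : ∀ e₁ ∈ F.edgeSet, ∀ e₂ ∈ F.edgeSet, e₁ ≠ e₂ → (∀ a ∉ P, a ∈ e₁ ↔ a ∈ e₂) →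
      ∃ z ∉ P, ∀ ρ : W → V, (∀ p ∈ P, ρ p = τ p) →
        ((Finset.univ.filter fun x => e₁.map (Function.update ρ z x) ∈ G.edgeSet ∧
          e₂.map (Function.update ρ z x) ∈ G.edgeSet ∧
          φ (e₁.map (Function.update ρ z x)) = φ (e₂.map (Function.update ρ z x))).card : ℝ) ≤
        ζ * n) :
    |((pinnedEmbeddings F G φ (fun c => (𝒱 (q c)).toFinset) P τ).ncard : ℝ) -
      d ^ (F.edgeFinset.filter fun e => ∃ a ∈ e, a ∉ P).card * n ^ Pᶜ.card| ≤
      ε * (d ^ (F.edgeFinset.filter fun e => ∃ a ∈ e, a ∉ P).card * n ^ Pᶜ.card) := by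
  have hle : ∀ i, ((𝒱 i).ncard : ℝ) ≤ 2 * n := fun i => by
    have := (abs_le.1 (hcard i)).2
    nlinarith
  have hdisj : ∀ i j, i ≠ j → Disjoint (𝒱 i).toFinset (𝒱 j).toFinset := fun i j hij => by
    rw [Finset.disjoint_left]
    intro x hi hj
    exact hij ((h𝒱 x).unique (Set.mem_toFinset.1 hi) (Set.mem_toFinset.1 hj))
  have hT : ∀ c, (((𝒱 (q c)).toFinset.card : ℝ)) ≤ 2 * n := fun c => by
    rw [← Set.ncard_eq_toFinset_card']
    exact hle _
  refine (abs_ncard_pinnedEmbeddings_sub_le F G φ (fun c => (𝒱 (q c)).toFinset) P τ d ζ n hd.le hd1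
    hζ hn hζn (fun p hp => Set.mem_toFinset.2 (hτ p hp)) hτi hτadj hT ?_ ?_ ?_ hspec).trans ?_
  · intro c hc
    refine abs_sub_mul_le_of_abs_sub_le (by positivity) (pow_le_one₀ hd.le hd1) hζ (hcard (q c))
      (hle _) ?_
    convert hS c hc using 5
    rw [← Set.ncard_coe_finset]
    congr 1
    ext z
    simp [pinnedTargets, hc]
  · intro a b hab X hX Y hY
    refine (RegularPair.abs_card_sub_le hd.le hd1 (hdisj _ _ (hq a b hab)) ?_ hζ hX hY).trans ?_
    · simpa using (hreg _ _ (hq a b hab)).1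
    · rw [pow_two]
      gcongr
      · exact hT a
      · exact hT b
  · intro x c
    have := hφ x c
    rw [← Set.ncard_coe_finset]
    simpa using this
  · have hPW : Pᶜ.card ≤ Fintype.card W := Finset.card_le_univ _
    have h2 : (2 : ℝ) ^ Pᶜ.card ≤ 2 ^ Fintype.card W := pow_le_pow_right₀ (by norm_num) hPW
    have hε0 : 0 ≤ ε := by
      by_contra! h
      have h3 : ε * d ^ F.edgeFinset.card < 0 := mul_neg_of_neg_of_pos h (by positivity)
      have h4 : 0 ≤ ((F.edgeFinset.card + 2 * Fintype.card W + Fintype.card W ^ 2 +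
        F.edgeFinset.card ^ 2 : ℝ)) * 2 ^ Fintype.card W * ζ := by positivity
      linarith
    calc ((F.edgeFinset.card + 2 * Fintype.card W + Fintype.card W ^ 2 +
            F.edgeFinset.card ^ 2 : ℝ)) * (ζ * (2 * n) ^ Pᶜ.card)
        = ((F.edgeFinset.card + 2 * Fintype.card W + Fintype.card W ^ 2 +
            F.edgeFinset.card ^ 2 : ℝ)) * 2 ^ Pᶜ.card * ζ * n ^ Pᶜ.card := by
          rw [mul_pow]; ring
      _ ≤ ((F.edgeFinset.card + 2 * Fintype.card W + Fintype.card W ^ 2 +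
            F.edgeFinset.card ^ 2 : ℝ)) * 2 ^ Fintype.card W * ζ * n ^ Pᶜ.card := by gcongr
      _ ≤ ε * d ^ F.edgeFinset.card * n ^ Pᶜ.card := by gcongr
      _ ≤ ε * (d ^ (F.edgeFinset.filter fun e => ∃ a ∈ e, a ∉ P).card * n ^ Pᶜ.card) := by
          rw [mul_assoc]
          gcongr ?_ * (?_ * ?_)
          exact pow_le_pow_of_le_one hd.le hd1 (Finset.card_filter_le _ _)

open Classical in
theorem card_perm_filter_apply_eq {W : Type*} [Fintype W] {r : ℕ} {𝒳 : Fin r → Set W} {f : ℕ}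
    (p : W → Fin r) (hp : ∀ x i, x ∈ 𝒳 i ↔ p x = i) (hf : ∀ i, (𝒳 i).ncard = f) (k : Fin r) :
    (Finset.univ.filter fun q : Equiv.Perm (Fin r) × W => q.1 (p q.2) = k).card =
      r.factorial * f := by
  rw [Finset.card_filter, Fintype.sum_prod_type]
  simp_rw [← Finset.card_filter]
  rw [Finset.sum_const_nat (m := f), Finset.card_univ, Fintype.card_perm, Fintype.card_fin]
  intro π _
  rw [← hf (π.symm k), ← Set.ncard_coe_finset]
  congr 1
  ext x
  simp [hp, Equiv.eq_symm_apply]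

open Classical in
/-- The number of rainbow copies through a given vertex. -/
theorem abs_rCount_vertex_sub_le {V W : Type*} [Fintype V] [Fintype W] {r f : ℕ}
    {F : SimpleGraph W} {𝒳 : Fin r → Set W} {G : SimpleGraph V} {𝒱 : Fin r → Set V}
    {φ : Sym2 V → ℕ} {d ζ n ε : ℝ} (hd : 0 < d) (hd1 : d ≤ 1) (hζ : 0 ≤ ζ) (hζ1 : ζ ≤ 1)
    (hn : 0 ≤ n) (hζn : 1 ≤ ζ * n)
    (hε : (F.edgeFinset.card + 2 * Fintype.card W + Fintype.card W ^ 2 + F.edgeFinset.card ^ 2) *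
      2 ^ Fintype.card W * ζ ≤ ε * d ^ F.edgeFinset.card)
    (h𝒱 : ∀ x, ∃! i, x ∈ 𝒱 i) (hφ : LBounded G φ (ζ * n))
    (hcard : ∀ i, |((𝒱 i).ncard : ℝ) - n| ≤ ζ * n)
    (hreg : ∀ i j, i ≠ j → SuperregularPair G (𝒱 i) (𝒱 j) ζ d)
    (p : W → Fin r) (hp : ∀ x i, x ∈ 𝒳 i ↔ p x = i) (hf : ∀ i, (𝒳 i).ncard = f)
    (hne : ∀ i, (𝒳 i).Nonempty) (hind : ∀ a b, F.Adj a b → p a ≠ p b) (u : V) :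
    |(rCount F 𝒳 G 𝒱 φ (fun H => u ∈ H.verts) : ℝ) -
      ((r.factorial * f : ℕ) : ℝ) * (d ^ F.edgeFinset.card * n ^ (Fintype.card W - 1)) /
        autXCard F 𝒳| ≤
    ε * (((r.factorial * f : ℕ) : ℝ) * (d ^ F.edgeFinset.card * n ^ (Fintype.card W - 1)) /
        autXCard F 𝒳) := by
  have : Nonempty V := ⟨u⟩
  obtain ⟨k, hk, hk'⟩ := h𝒱 u
  have key := abs_rCount_sub_le (F := F) (G := G) (φ := φ) (fun H => u ∈ H.verts) p hp hne h𝒱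
    (fun x : W => {x}) (fun _ _ => u) (fun c => by simp)
    (fun ψ hψ x y hx hy => hψ (by
      rw [hx x (Finset.mem_singleton_self x), hy y (Finset.mem_singleton_self y)]))
    (d ^ F.edgeFinset.card * n ^ (Fintype.card W - 1)) ε ?_
  · have e : (Finset.univ.filter fun q : Equiv.Perm (Fin r) × W =>
        ∀ x ∈ ({q.2} : Finset W), u ∈ 𝒱 (q.1 (p x))).card = r.factorial * f := by
      rw [← card_perm_filter_apply_eq p hp hf k]
      congr 1
      ext q
      simp only [Finset.mem_filter, Finset.mem_univ, true_and, Finset.mem_singleton, forall_eq]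
      exact ⟨fun h => hk' _ h, fun h => h ▸ hk⟩
    rw [← e]
    convert key
  · intro π x hx
    have hx' : u ∈ 𝒱 (π (p x)) := hx x (Finset.mem_singleton_self x)
    have hq : ∀ a b, F.Adj a b → π (p a) ≠ π (p b) := fun a b hab h => hind a b hab (π.injective h)
    have h := abs_ncard_pinnedEmbeddings_sub_le_of_superregular hd hd1 hζ hζ1 hn hζn hε h𝒱 hφ hcard
      hreg (q := fun x => π (p x)) hq {x} (fun _ => u) hx (by simp) ?_ ?_ ?_
    · have e1 : (F.edgeFinset.filter fun e => ∃ a ∈ e, a ∉ ({x} : Finset W)) = F.edgeFinset := by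
        refine Finset.filter_true_of_mem fun e he => ?_
        induction e using Sym2.ind with
        | _ a b =>
        have hab : a ≠ b := SimpleGraph.Adj.ne (SimpleGraph.mem_edgeFinset.1 he)
        by_cases hax : a = x
        · exact ⟨b, by simp, by simpa [← hax] using hab.symm⟩
        · exact ⟨a, by simp, by simpa using hax⟩
      rw [e1, Finset.card_compl, Finset.card_singleton] at h
      exact h
    · intro a ha b hb hab
      rw [Finset.mem_singleton.1 ha, Finset.mem_singleton.1 hb] at hab
      exact absurd hab (F.irrefl)
    · intro c hc
      by_cases hxc : F.Adj x c
      · have := (hreg _ _ (hq x c hxc)).2.1 u hx'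
        convert this using 5
        · rw [degIn, Set.inter_comm]
          congr 2
          ext z
          simp [hxc]
        · rw [Finset.filter_true_of_mem (by simpa using hxc)]
          simp
      · simp [hxc, Finset.filter_singleton]
        positivity
    · intro e₁ h₁ e₂ h₂ hne12 hagree
      obtain ⟨z, _, _, hz⟩ := exists_eq_of_edges_agree_off_pair (x := x) (y := x) h₁ h₂ hne12
        (fun a ha _ => hagree a (by simpa using ha))
      exact absurd (by rcases hz with ⟨h1, h2⟩ | ⟨h1, h2⟩ <;> rw [h1, h2]) hne12

open Classical in
theorem mul_card_perm_dart_filter {W : Type*} [Fintype W] {r : ℕ} {F : SimpleGraph W}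
    (p : W → Fin r) (hind : ∀ a b, F.Adj a b → p a ≠ p b) {i j : Fin r} (hij : i ≠ j) :
    (r * (r - 1)) * (Finset.univ.filter fun q : Equiv.Perm (Fin r) × F.Dart =>
      q.1 (p q.2.fst) = i ∧ q.1 (p q.2.snd) = j).card =
      2 * F.edgeFinset.card * r.factorial := by
  rw [Finset.card_filter, Fintype.sum_prod_type_right]
  simp_rw [← Finset.card_filter]
  rw [Finset.mul_sum, Finset.sum_const_nat (m := r.factorial), Finset.card_univ,
    SimpleGraph.dart_card_eq_twice_card_edges]
  intro k _
  have := card_perm_two_points (hind _ _ k.adj) hij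
  rwa [Fintype.card_fin] at this

open Classical in
theorem card_filter_not_subset_pair {W : Type*} [Fintype W] {F : SimpleGraph W} {x y : W}
    (hxy : F.Adj x y) :
    (F.edgeFinset.filter fun e => ∃ a ∈ e, a ∉ ({x, y} : Finset W)).card =
      F.edgeFinset.card - 1 := by
  rw [← Finset.card_erase_of_mem (SimpleGraph.mem_edgeFinset.2 (show s(x, y) ∈ F.edgeSet from hxy))]
  congr 1
  ext e
  induction e using Sym2.ind with
  | _ a b =>
  simp only [Finset.mem_filter, Finset.mem_erase, SimpleGraph.mem_edgeFinset,
    SimpleGraph.mem_edgeSet, Sym2.mem_iff, Finset.mem_insert, Finset.mem_singleton, ne_eq,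
    Sym2.eq_iff]
  constructor
  · rintro ⟨hab, c, hc⟩
    refine ⟨?_, hab⟩
    grind
  · rintro ⟨h, hab⟩
    refine ⟨hab, ?_⟩
    have hne := hab.ne
    by_cases ha : a = x ∨ a = y
    · exact ⟨b, Or.inr rfl, by grind⟩
    · exact ⟨a, Or.inl rfl, ha⟩

open Classical in
/-- The number of rainbow copies through a given edge. -/
theorem abs_rCount_edge_sub_le {V W : Type*} [Fintype V] [Fintype W] {r : ℕ}
    {F : SimpleGraph W} {𝒳 : Fin r → Set W} {G : SimpleGraph V} {𝒱 : Fin r → Set V}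
    {φ : Sym2 V → ℕ} {d ζ n ε : ℝ} (hd : 0 < d) (hd1 : d ≤ 1) (hζ : 0 ≤ ζ) (hζ1 : ζ ≤ 1)
    (hn : 0 ≤ n) (hζn : 1 ≤ ζ * n)
    (hε : (F.edgeFinset.card + 2 * Fintype.card W + Fintype.card W ^ 2 + F.edgeFinset.card ^ 2) *
      2 ^ Fintype.card W * ζ ≤ ε * d ^ F.edgeFinset.card)
    (h𝒱 : ∀ x, ∃! i, x ∈ 𝒱 i) (hφ : LBounded G φ (ζ * n))
    (hcard : ∀ i, |((𝒱 i).ncard : ℝ) - n| ≤ ζ * n)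
    (hreg : ∀ i j, i ≠ j → SuperregularPair G (𝒱 i) (𝒱 j) ζ d)
    (p : W → Fin r) (hp : ∀ x i, x ∈ 𝒳 i ↔ p x = i)
    (hne : ∀ i, (𝒳 i).Nonempty) (hind : ∀ a b, F.Adj a b → p a ≠ p b) {v w : V} {i j : Fin r}
    (hvw : G.Adj v w) (hv : v ∈ 𝒱 i) (hw : w ∈ 𝒱 j) (hij : i ≠ j)
    (htri : ((∀ k, k ≠ i → k ≠ j →
          |(codegIn G v w (𝒱 k) : ℝ) - d ^ 2 * ((𝒱 k).ncard : ℝ)| ≤ ζ * ((𝒱 k).ncard : ℝ)) ∧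
        (monoCodeg G φ v w : ℝ) < ζ * n) ∨ F.CliqueFree 3) :
    ∃ R : ℕ, (r * (r - 1)) * R = 2 * F.edgeFinset.card * r.factorial ∧
    |(rCount F 𝒳 G 𝒱 φ (fun H => s(v, w) ∈ H.edgeSet) : ℝ) -
      R * (d ^ (F.edgeFinset.card - 1) * n ^ (Fintype.card W - 2)) / autXCard F 𝒳| ≤
    ε * (R * (d ^ (F.edgeFinset.card - 1) * n ^ (Fintype.card W - 2)) / autXCard F 𝒳) := by
  have : Nonempty V := ⟨v⟩
  have hvwne : v ≠ w := hvw.ne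
  have hτ : ∀ (k : F.Dart) (S : W → Prop), (∀ x ∈ ({k.fst, k.snd} : Finset W), S x) ↔
      S k.fst ∧ S k.snd := fun k S => by simp
  have hd1' : ∀ k : F.Dart, (if k.fst = k.snd then w else v) = v := fun k => by
    simp [k.adj.ne]
  have key := abs_rCount_sub_le (F := F) (G := G) (φ := φ) (fun H => s(v, w) ∈ H.edgeSet) p hp hne
    h𝒱 (fun k : F.Dart => {k.fst, k.snd}) (fun k x => if x = k.snd then w else v) ?_ ?_
    (d ^ (F.edgeFinset.card - 1) * n ^ (Fintype.card W - 2)) ε ?_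
  · refine ⟨_, ?_, key⟩
    rw [← mul_card_perm_dart_filter p hind hij]
    congr 2
    ext q
    simp only [Finset.mem_filter, Finset.mem_univ, true_and, hτ, hd1', if_true]
    exact ⟨fun h => ⟨(h𝒱 v).unique h.1 hv, (h𝒱 w).unique h.2 hw⟩, fun h => h.1 ▸ h.2 ▸ ⟨hv, hw⟩⟩
  · intro c
    simp only [hτ, hd1', if_true, edgeSet_toSubgraph]
    constructor
    · rintro ⟨e, he, h⟩
      induction e using Sym2.ind with
      | _ a b =>
      have hab : F.Adj a b := he
      rcases Sym2.eq_iff.1 h with h | h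
      · exact ⟨⟨(a, b), hab⟩, h⟩
      · exact ⟨⟨(b, a), hab.symm⟩, h.2, h.1⟩
    · rintro ⟨k, h1, h2⟩
      exact ⟨s(k.fst, k.snd), k.adj, by rw [Sym2.map_mk]; simp [h1, h2]⟩
  · intro ψ hψ k k'
    simp only [hτ, hd1', if_true]
    rintro ⟨h1, h2⟩ ⟨h3, h4⟩
    exact SimpleGraph.Dart.ext _ _ (Prod.ext (hψ (h1.trans h3.symm)) (hψ (h2.trans h4.symm)))
  · intro π k hx
    rw [hτ, if_pos rfl, hd1'] at hx
    obtain ⟨x, y, hxy, rfl⟩ : ∃ x y, ∃ hxy : F.Adj x y, k = ⟨(x, y), hxy⟩ :=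
      ⟨k.fst, k.snd, k.adj, rfl⟩
    have hxyne : x ≠ y := hxy.ne
    obtain ⟨hx1, hx2⟩ := hx
    simp only at hx1 hx2
    have hxi := (h𝒱 v).unique hx1 hv
    have hyj := (h𝒱 w).unique hx2 hw
    have hq : ∀ a b, F.Adj a b → π (p a) ≠ π (p b) := fun a b hab h => hind a b hab (π.injective h)
    have h := abs_ncard_pinnedEmbeddings_sub_le_of_superregular hd hd1 hζ hζ1 hn hζn hε h𝒱 hφ hcard
      hreg (q := fun x => π (p x)) hq {x, y} (fun a => if a = y then w else v) ?_ ?_ ?_ ?_ ?_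
    · rw [card_filter_not_subset_pair hxy, Finset.card_compl, Finset.card_pair hxyne] at h
      exact h
    · simp [hxyne, hx1, hx2]
    · rw [Finset.coe_pair, Set.injOn_pair]
      simp [hxyne, hvwne]
    · simp only [Finset.mem_insert, Finset.mem_singleton]
      rintro a (rfl | rfl) b (rfl | rfl) hab
      · exact absurd hab F.irrefl
      · simpa [hxyne] using hvw
      · simpa [hxyne] using hvw.symm
      · exact absurd hab F.irrefl
    · intro c hc
      simp only [Finset.mem_insert, Finset.mem_singleton, not_or] at hc
      simp only [Finset.mem_insert, Finset.mem_singleton, forall_eq_or_imp, forall_eq, if_true,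
        hxyne, if_false]
      rw [Finset.filter_insert, Finset.filter_singleton]
      by_cases hxc : F.Adj x c <;> by_cases hyc : F.Adj y c
      · have h3 : ¬ F.CliqueFree 3 := fun h => h {x, y, c} (SimpleGraph.is3Clique_iff.2
          ⟨x, y, c, hxy, hxc, hyc, rfl⟩)
        have := (htri.resolve_right h3).1 (π (p c)) (fun h => hq x c hxc (hxi.trans h.symm))
          (fun h => hq y c hyc (hyj.trans h.symm))
        convert this using 5
        · rw [codegIn, Set.inter_comm]
          congr 2
          ext z
          simp [hxc, hyc]
        · simp [hxc, hyc, hxyne]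
      · have := (hreg _ _ (hq x c hxc)).2.1 v hx1
        convert this using 5
        · rw [degIn, Set.inter_comm]
          congr 2
          ext z
          simp [hxc, hyc]
        · simp [hxc, hyc]
      · have := (hreg _ _ (hq y c hyc)).2.1 w hx2
        convert this using 5
        · rw [degIn, Set.inter_comm]
          congr 2
          ext z
          simp [hxc, hyc]
        · simp [hxc, hyc]
      · simp [hxc, hyc]
        positivity
    · intro e₁ h₁ e₂ h₂ hne12 hagree
      obtain ⟨z, hzx, hzy, hz⟩ := exists_eq_of_edges_agree_off_pair (x := x) (y := y) h₁ h₂ hne12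
        (fun a ha ha' => hagree a (by simp [ha, ha']))
      refine ⟨z, by simp [hzx, hzy], fun ρ hρ => ?_⟩
      have hρx : ρ x = v := by simpa [hxyne] using hρ x (by simp)
      have hρy : ρ y = w := by simpa using hρ y (by simp)
      have hadj : F.Adj x z ∧ F.Adj y z := by
        rcases hz with ⟨rfl, rfl⟩ | ⟨rfl, rfl⟩
        · exact ⟨h₁, h₂⟩
        · exact ⟨h₂, h₁⟩
      have h3 : ¬ F.CliqueFree 3 := fun h => h {x, y, z} (SimpleGraph.is3Clique_iff.2
        ⟨x, y, z, hxy, hadj.1, hadj.2, rfl⟩)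
      refine le_trans ?_ (htri.resolve_right h3).2.le
      rw [monoCodeg, Nat.cast_le, ← Set.ncard_coe_finset]
      refine Set.ncard_le_ncard (fun t ht => ?_) (Set.toFinite _)
      have ht' := (Finset.mem_filter.1 (Finset.mem_coe.1 ht)).2
      rcases hz with ⟨rfl, rfl⟩ | ⟨rfl, rfl⟩
      · simp only [Sym2.map_mk, Function.update_of_ne hzx.symm, Function.update_of_ne hzy.symm,
          hρx, hρy, Function.update_self] at ht'
        exact ht'
      · simp only [Sym2.map_mk, Function.update_of_ne hzx.symm, Function.update_of_ne hzy.symm,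
          hρx, hρy, Function.update_self] at ht'
        exact ⟨ht'.2.1, ht'.1, ht'.2.2.symm⟩

theorem rCount_eq_zero_of_isEmpty {V W : Type*} [IsEmpty W] {r : ℕ} (F : SimpleGraph W)
    (𝒳 : Fin r → Set W) (G : SimpleGraph V) (𝒱 : Fin r → Set V) (φ : Sym2 V → ℕ)
    {Q : G.Subgraph → Prop} (hQ : ∀ H, Q H → H.verts.Nonempty) : rCount F 𝒳 G 𝒱 φ Q = 0 := by
  rw [rCount]
  convert Set.ncard_empty G.Subgraph
  refine Set.eq_empty_iff_forall_notMem.2 ?_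
  rintro H ⟨_, hH, e, _⟩
  obtain ⟨x, hx⟩ := hQ H hH
  exact IsEmpty.false (e.symm ⟨x, hx⟩)

/-- Lemma 2.3 (partite rainbow counting lemma). -/
theorem stmt_9 :
    ∀ d : ℝ, 0 < d → d ≤ 1 → ∀ r C f h : ℕ,
    ∃ ε₀ : ℝ, 0 < ε₀ ∧ ∀ ε : ℝ, 0 < ε → ε ≤ ε₀ →
    ∃ ζ₀ : ℝ, 0 < ζ₀ ∧ ∀ ζ : ℝ, 0 < ζ → ζ ≤ ζ₀ →
    ∃ n₀ : ℕ, ∀ n : ℕ, n₀ ≤ n →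
    ∀ (F : SimpleGraph (Fin (f * r))) (𝒳 : Fin r → Set (Fin (f * r))),
      F.edgeSet.ncard = h →
      (∀ x, ∃! i, x ∈ 𝒳 i) →
      (∀ i, (𝒳 i).ncard = f) →
      (∀ i, ∀ x ∈ 𝒳 i, ∀ y ∈ 𝒳 i, ¬ F.Adj x y) →
    ∀ (N : ℕ) (G : SimpleGraph (Fin N)) (𝒱 : Fin r → Set (Fin N)),
      (∀ x, ∃! i, x ∈ 𝒱 i) →
      (∀ i, ∀ x ∈ 𝒱 i, ∀ y ∈ 𝒱 i, ¬ G.Adj x y) →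
    ∀ φ : Sym2 (Fin N) → ℕ,
      GBounded G φ ((C : ℝ) * n) → LBounded G φ (ζ * n) →
    ∀ (j' j'' : Fin r) (v w : Fin N), G.Adj v w → v ∈ 𝒱 j' → w ∈ 𝒱 j'' →
      -- (A1)
      (∀ i, |((𝒱 i).ncard : ℝ) - n| ≤ ζ * n) →
      -- (A2)
      (∀ i j, i ≠ j → SuperregularPair G (𝒱 i) (𝒱 j) ζ d) →
      -- (A3)
      (((∀ i, i ≠ j' → i ≠ j'' →
          |(codegIn G v w (𝒱 i) : ℝ) - d ^ 2 * ((𝒱 i).ncard : ℝ)| ≤ ζ * ((𝒱 i).ncard : ℝ)) ∧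
        (monoCodeg G φ v w : ℝ) < ζ * n) ∨ F.CliqueFree 3) →
    ∀ u : Fin N,
      (|(rCount F 𝒳 G 𝒱 φ (fun H => u ∈ H.verts) : ℝ) -
          (r.factorial : ℝ) * f * d ^ h * (n : ℝ) ^ (f * r - 1) / (autXCard F 𝒳 : ℝ)|
        ≤ ε * ((r.factorial : ℝ) * f * d ^ h * (n : ℝ) ^ (f * r - 1) / (autXCard F 𝒳 : ℝ))) ∧
      (|(rCount F 𝒳 G 𝒱 φ (fun H => s(v, w) ∈ H.edgeSet) : ℝ) -
          (r.factorial : ℝ) * h * d ^ (h - 1) * (n : ℝ) ^ (f * r - 2) /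
            (((r : ℝ) * ((r : ℝ) - 1) / 2) * (autXCard F 𝒳 : ℝ))|
        ≤ ε * ((r.factorial : ℝ) * h * d ^ (h - 1) * (n : ℝ) ^ (f * r - 2) /
            (((r : ℝ) * ((r : ℝ) - 1) / 2) * (autXCard F 𝒳 : ℝ)))) := by
  intro d hd hd1 r C f h
  refine ⟨1, one_pos, fun ε hε _ => ?_⟩
  obtain ⟨M, hM⟩ : ∃ M : ℝ, M = ((h : ℝ) + 2 * (f * r : ℕ) + ((f * r : ℕ) : ℝ) ^ 2 + (h : ℝ) ^ 2) *
    2 ^ (f * r) := ⟨_, rfl⟩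
  have hM0 : 0 ≤ M := by rw [hM]; positivity
  refine ⟨min 1 (ε * d ^ h / (M + 1)), lt_min one_pos (by positivity), fun ζ hζ hζ0 => ?_⟩
  have hζ1 : ζ ≤ 1 := hζ0.trans (min_le_left _ _)
  have hMζ : M * ζ ≤ ε * d ^ h := by
    have h1 := (le_div_iff₀ (by positivity)).1 (hζ0.trans (min_le_right _ _))
    linarith
  refine ⟨⌈1 / ζ⌉₊, fun n hn F 𝒳 hFh h𝒳 h𝒳f h𝒳i N G 𝒱 h𝒱 h𝒱i φ _ hφ j' j'' v w hvw hv hw hA1 hA2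
    hA3 u => ?_⟩
  have hζn : 1 ≤ ζ * n := by
    rw [← div_le_iff₀' hζ]
    exact (Nat.le_ceil _).trans (by exact_mod_cast hn)
  rcases Nat.eq_zero_or_pos f with rfl | hf
  · have : IsEmpty (Fin (0 * r)) := by rw [Nat.zero_mul]; infer_instance
    have hh : h = 0 := by
      rw [← hFh, Subsingleton.elim F ⊥]
      simp
    rw [rCount_eq_zero_of_isEmpty F 𝒳 G 𝒱 φ fun H hu => ⟨u, hu⟩,
      rCount_eq_zero_of_isEmpty F 𝒳 G 𝒱 φ (Q := fun H => s(v, w) ∈ H.edgeSet)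
        fun H hvw => ⟨v, H.edge_vert hvw⟩, hh]
    simp
  classical
  choose p hp hp' using h𝒳
  have hp_iff : ∀ x i, x ∈ 𝒳 i ↔ p x = i := fun x i =>
    ⟨fun hx => (hp' x i hx).symm, fun h => h ▸ hp x⟩
  have hne : ∀ i, (𝒳 i).Nonempty := fun i =>
    Set.nonempty_of_ncard_ne_zero (by rw [h𝒳f i]; exact hf.ne')
  have hind : ∀ a b, F.Adj a b → p a ≠ p b := fun a b hab he =>
    h𝒳i (p a) a (hp a) b (he ▸ hp b) hab
  have hFh' : F.edgeFinset.card = h := by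
    rw [← hFh, Set.ncard_eq_toFinset_card']
    rfl
  have hbound : ((F.edgeFinset.card : ℝ) + 2 * Fintype.card (Fin (f * r)) +
      (Fintype.card (Fin (f * r)) : ℝ) ^ 2 + (F.edgeFinset.card : ℝ) ^ 2) *
      2 ^ Fintype.card (Fin (f * r)) * ζ ≤ ε * d ^ F.edgeFinset.card := by
    rw [Fintype.card_fin, hFh', ← hM]
    exact hMζ
  constructor
  · have := abs_rCount_vertex_sub_le hd hd1 hζ.le hζ1 n.cast_nonneg hζn hbound h𝒱 hφ hA1 hA2 p
      hp_iff h𝒳f hne hind u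
    rw [hFh', Fintype.card_fin, Nat.cast_mul, ← mul_assoc] at this
    exact this
  · have hij : j' ≠ j'' := fun h => h𝒱i j' v hv w (h ▸ hw) hvw
    obtain ⟨R, hR, key⟩ := abs_rCount_edge_sub_le hd hd1 hζ.le hζ1 n.cast_nonneg hζn hbound h𝒱 hφ
      hA1 hA2 p hp_iff hne hind hvw hv hw hij hA3
    rw [hFh', Fintype.card_fin] at key
    rw [hFh'] at hR
    have hr : 2 ≤ r := by
      have h1 := j'.isLt
      have h2 := j''.isLt
      have h3 : (j' : ℕ) ≠ j'' := fun h => hij (Fin.ext h)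
      omega
    have hR' : ((r : ℝ) * ((r : ℝ) - 1)) * R = 2 * h * r.factorial := by
      have : ((r * (r - 1) * R : ℕ) : ℝ) = ((2 * h * r.factorial : ℕ) : ℝ) := by rw [hR]
      push_cast [Nat.cast_sub (show 1 ≤ r by omega)] at this
      exact this
    have hr0 : (0 : ℝ) < (r : ℝ) * ((r : ℝ) - 1) := by
      have : (2 : ℝ) ≤ r := by exact_mod_cast hr
      nlinarith
    have hRh : (R : ℝ) = r.factorial * h / ((r : ℝ) * ((r : ℝ) - 1) / 2) := by
      rw [eq_div_iff (by positivity)]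
      linarith
    have e : (r.factorial : ℝ) * h * d ^ (h - 1) * (n : ℝ) ^ (f * r - 2) /
        (((r : ℝ) * ((r : ℝ) - 1) / 2) * (autXCard F 𝒳 : ℝ)) =
        R * (d ^ (h - 1) * (n : ℝ) ^ (f * r - 2)) / autXCard F 𝒳 := by
      rw [hRh, mul_assoc, mul_div_mul_comm]
      exact (mul_div_assoc _ _ _).symm
    rw [e]
    exact key
end

section
/- For all d ∈ (0,1] and C, f, h ∈ ℕ there exists ε₀ > 0; for every 0 < ε ≤ ε₀ there exists ζ₀ > 0; for every 0 < ζ ≤ ζ₀ there exists n₀ ∈ ℕ such that the following holds for all n ≥ n₀. Let F be a graph with f vertices and h edges, let G be an n-vertex (ζ,d)-quasirandom graph, let φ be an edge-colouring of G that is Cn-bounded and locally ζn-bounded, and fix an edge vw of G. Assume that either vw is not an edge of Ir_G(ζ,d) ∪ Ir^φ_G(ζn), or F is triangle-free. Then for every vertex u of G: r_G(F,u) = (1±ε/3)·f·d^h·n^{f−1}/|Aut(F)|, and r_G(F,vw) = (1±ε/3)·2h·d^{h−1}·n^{f−2}/|Aut(F)|. -/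
open Paper

/-- The number of `φ`-rainbow copies of `F` in `G` satisfying the containment
condition `P`. -/
noncomputable def rCountQ {V W : Type*} (F : SimpleGraph W) (G : SimpleGraph V)
    (φ : Sym2 V → ℕ) (P : G.Subgraph → Prop) : ℕ :=
  ({H : G.Subgraph | Rainbow φ H.edgeSet ∧ P H ∧ Nonempty (F ≃g H.coe)}).ncard

namespace RainbowCounting

open Finset Function

section Bilinear

variable {V : Type*} {G : SimpleGraph V} {d ζ : ℝ}

/-- The indicator function of the edge set of `G`. -/
noncomputable def edgeInd (G : SimpleGraph V) : Sym2 V → ℝ :=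
  G.edgeSet.indicator 1

lemma edgeInd_of_adj {a b : V} (h : G.Adj a b) : edgeInd G s(a, b) = 1 :=
  Set.indicator_of_mem (s := G.edgeSet) h 1

lemma edgeInd_of_not_adj {a b : V} (h : ¬ G.Adj a b) : edgeInd G s(a, b) = 0 :=
  Set.indicator_of_notMem (s := G.edgeSet) h 1

lemma edgeInd_eq_zero_or_one (e : Sym2 V) : edgeInd G e = 0 ∨ edgeInd G e = 1 :=
  Set.indicator_eq_zero_or_self G.edgeSet 1 e

lemma edgeInd_nonneg (e : Sym2 V) : 0 ≤ edgeInd G e := by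
  rcases edgeInd_eq_zero_or_one (G := G) e with h | h <;> simp [h]

lemma edgeInd_le_one (e : Sym2 V) : edgeInd G e ≤ 1 := by
  rcases edgeInd_eq_zero_or_one (G := G) e with h | h <;> simp [h]

lemma abs_edgeInd_sub_le (hd0 : 0 ≤ d) (hd1 : d ≤ 1) (e : Sym2 V) : |edgeInd G e - d| ≤ 1 := by
  rw [abs_le]
  constructor <;> linarith [edgeInd_nonneg (G := G) e, edgeInd_le_one (G := G) e]

lemma abs_prod_edgeInd_le_one {ι : Type*} (E : Finset ι) (f : ι → Sym2 V) :
    |∏ e ∈ E, edgeInd G (f e)| ≤ 1 := by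
  rw [abs_of_nonneg (prod_nonneg fun _ _ => edgeInd_nonneg _)]
  exact prod_le_one (fun _ _ => edgeInd_nonneg _) fun _ _ => edgeInd_le_one _

variable [Fintype V]

lemma sum_edgeInd (u : V) : ∑ a, edgeInd G s(u, a) = degIn G u Set.univ := by
  classical
  have h : ∀ a, edgeInd G s(u, a) = if G.Adj u a then 1 else 0 := fun a => by
    split_ifs with h
    exacts [edgeInd_of_adj h, edgeInd_of_not_adj h]
  simp_rw [h, sum_boole, degIn, Set.inter_univ, Set.ncard_eq_toFinset_card']
  congr 2
  ext a
  simp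

lemma sum_edgeInd_mul_edgeInd (u v : V) :
    ∑ a, edgeInd G s(u, a) * edgeInd G s(v, a) = codegIn G u v Set.univ := by
  classical
  have h : ∀ a, edgeInd G s(u, a) * edgeInd G s(v, a) =
      if G.Adj u a ∧ G.Adj v a then 1 else 0 := fun a => by
    split_ifs with h
    · rw [edgeInd_of_adj h.1, edgeInd_of_adj h.2, one_mul]
    · rcases not_and_or.1 h with h | h <;> simp [edgeInd_of_not_adj h]
  simp_rw [h, sum_boole, codegIn, Set.inter_univ, Set.ncard_eq_toFinset_card']
  congr 2
  ext a
  simp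

lemma abs_degree_sub_le (hG : Quasirandom G ζ d) (u : V) :
    |(degIn G u Set.univ : ℝ) - d * Fintype.card V| ≤ ζ * Fintype.card V := by
  simpa [Set.ncard_univ, Nat.card_eq_fintype_card] using hG.1 u (Set.mem_univ u)

open Classical in
/-- The ordered pairs of distinct vertices with irregular codegree. -/
noncomputable def irregularPairs (G : SimpleGraph V) (d ζ : ℝ) : Finset (V × V) :=
  {p : V × V | p.1 ≠ p.2 ∧
    ¬ |(codegIn G p.1 p.2 Set.univ : ℝ) - d ^ 2 * Fintype.card V| ≤ ζ * Fintype.card V}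

lemma card_irregularPairs_le (hG : Quasirandom G ζ d) :
    (#(irregularPairs G d ζ) : ℝ) ≤ 2 * (ζ * (Fintype.card V : ℝ) ^ 2) := by
  classical
  have h := hG.2
  rw [Set.ncard_univ, Nat.card_eq_fintype_card] at h
  have key : #(irregularPairs G d ζ) ≤
      2 * #((irregularPairs G d ζ).image fun p => s(p.1, p.2)) := by
    refine card_le_mul_card_image _ 2 fun e _ => ?_
    induction e with | h a b =>
    refine (card_le_card (t := {(a, b), (b, a)}) fun p hp => ?_).trans card_le_two
    obtain ⟨x, y⟩ := p
    have := (mem_filter.1 hp).2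
    simpa using this
  have key' : #((irregularPairs G d ζ).image fun p => s(p.1, p.2)) ≤
      ({p : Sym2 V | ∃ u v, p = s(u, v) ∧ u ≠ v ∧ u ∈ Set.univ ∧ v ∈ Set.univ ∧
        ¬ (|(codegIn G u v Set.univ : ℝ) - d ^ 2 * Fintype.card V| ≤
          ζ * Fintype.card V)} : Set (Sym2 V)).ncard := by
    rw [← Set.ncard_coe_finset]
    refine Set.ncard_le_ncard ?_ (Set.toFinite _)
    intro e he
    obtain ⟨p, hp, rfl⟩ := mem_image.1 (mem_coe.1 he)
    have hp := (mem_filter.1 hp).2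
    exact ⟨p.1, p.2, rfl, hp.1, trivial, trivial, hp.2⟩
  have k1 : (#(irregularPairs G d ζ) : ℝ) ≤
      2 * #((irregularPairs G d ζ).image fun p => s(p.1, p.2)) := by exact_mod_cast key
  have k2 := (Nat.cast_le (α := ℝ)).2 key'
  linarith

lemma sum_abs_codegree_le (hd0 : 0 ≤ d) (hd1 : d ≤ 1) (hG : Quasirandom G ζ d) (hζ : 0 ≤ ζ)
    (hn : 1 ≤ ζ * Fintype.card V) :
    ∑ b, ∑ c, |∑ a, (edgeInd G s(b, a) - d) * (edgeInd G s(c, a) - d)| ≤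
      6 * ζ * (Fintype.card V : ℝ) ^ 3 := by
  classical
  set n : ℝ := (Fintype.card V : ℝ) with hn'
  have hn0 : 0 ≤ n := Nat.cast_nonneg _
  have expand : ∀ b c, ∑ a, (edgeInd G s(b, a) - d) * (edgeInd G s(c, a) - d) =
      (codegIn G b c Set.univ - d ^ 2 * n) - d * (degIn G b Set.univ - d * n)
        - d * (degIn G c Set.univ - d * n) := by
    intro b c
    rw [← sum_edgeInd, ← sum_edgeInd, ← sum_edgeInd_mul_edgeInd]
    simp only [sub_mul, mul_sub, sum_sub_distrib, sum_const, card_univ, nsmul_eq_mul,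
      ← mul_sum, ← sum_mul]
    ring
  have trivialBound : ∀ b c,
      |∑ a, (edgeInd G s(b, a) - d) * (edgeInd G s(c, a) - d)| ≤ n := by
    intro b c
    refine (abs_sum_le_sum_abs _ _).trans ?_
    have : ∀ a ∈ univ, |(edgeInd G s(b, a) - d) * (edgeInd G s(c, a) - d)| ≤ 1 := by
      intro a _
      rw [abs_mul]
      exact mul_le_one₀ (abs_edgeInd_sub_le hd0 hd1 _) (abs_nonneg _)
        (abs_edgeInd_sub_le hd0 hd1 _)
    simpa [hn'] using sum_le_card_nsmul _ _ _ this
  have pointwise : ∀ p : V × V,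
      |∑ a, (edgeInd G s(p.1, a) - d) * (edgeInd G s(p.2, a) - d)| ≤
        3 * ζ * n + ((if p.1 = p.2 then n else 0) +
          (if p ∈ irregularPairs G d ζ then n else 0)) := by
    rintro ⟨b, c⟩
    have h0 : 0 ≤ 3 * ζ * n := by positivity
    by_cases h : b = c
    · have : (0 : ℝ) ≤ if (b, c) ∈ irregularPairs G d ζ then n else 0 := by
        split_ifs <;> simp [hn0]
      have := trivialBound b c
      simp only [if_pos h]
      linarith
    by_cases h2 : (b, c) ∈ irregularPairs G d ζ
    · have := trivialBound b c
      simp only [if_pos h2, if_neg h]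
      linarith
    · have h3 : |(codegIn G b c Set.univ : ℝ) - d ^ 2 * n| ≤ ζ * n := by
        by_contra h3
        exact h2 (mem_filter.2 ⟨mem_univ _, h, h3⟩)
      have hb := abs_degree_sub_le hG b
      have hc := abs_degree_sub_le hG c
      rw [if_neg h, if_neg h2]
      simp only [expand]
      have hb' : |d * ((degIn G b Set.univ : ℝ) - d * n)| ≤ ζ * n := by
        rw [abs_mul, abs_of_nonneg hd0]
        exact (mul_le_of_le_one_left (abs_nonneg _) hd1).trans hb
      have hc' : |d * ((degIn G c Set.univ : ℝ) - d * n)| ≤ ζ * n := by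
        rw [abs_mul, abs_of_nonneg hd0]
        exact (mul_le_of_le_one_left (abs_nonneg _) hd1).trans hc
      rw [abs_le] at *
      constructor <;> linarith [h3.1, h3.2, hb'.1, hb'.2, hc'.1, hc'.2]
  rw [← sum_product' (s := univ) (t := univ) (f := fun b c =>
    |∑ a, (edgeInd G s(b, a) - d) * (edgeInd G s(c, a) - d)|)]
  refine (sum_le_sum fun p _ => pointwise p).trans ?_
  rw [sum_add_distrib, sum_add_distrib, ← sum_filter, ← sum_filter]
  have diag : (#{p ∈ (univ : Finset V) ×ˢ (univ : Finset V) | p.1 = p.2} : ℝ) = n := by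
    rw [hn', ← card_univ, ← diag_card (univ : Finset V)]
    congr 2
    ext p
    simp
  simp only [sum_const, nsmul_eq_mul, diag]
  have hirr : (#{p ∈ (univ : Finset V) ×ˢ (univ : Finset V) | p ∈ irregularPairs G d ζ} : ℝ)
      ≤ 2 * (ζ * n ^ 2) := by
    refine le_trans ?_ (card_irregularPairs_le hG)
    exact_mod_cast card_le_card fun p hp => (mem_filter.1 hp).2
  have h1 := mul_le_mul_of_nonneg_right hirr hn0
  have h2 := mul_le_mul_of_nonneg_right hn (sq_nonneg n)
  rw [card_product, card_univ]
  push_cast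
  rw [← hn']
  nlinarith

/-- Quasirandomness controls the discrepancy of weighted edge counts. -/
theorem sq_discrepancy_le (hd0 : 0 ≤ d) (hd1 : d ≤ 1) (hG : Quasirandom G ζ d) (hζ : 0 ≤ ζ)
    (hn : 1 ≤ ζ * Fintype.card V) (P Q : V → ℝ) (hP : ∀ a, |P a| ≤ 1) (hQ : ∀ a, |Q a| ≤ 1) :
    (∑ a, ∑ b, (edgeInd G s(a, b) - d) * (P a * Q b)) ^ 2 ≤
      6 * ζ * (Fintype.card V : ℝ) ^ 4 := by
  classical
  set n : ℝ := (Fintype.card V : ℝ) with hn'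
  have h1 : ∑ a, ∑ b, (edgeInd G s(a, b) - d) * (P a * Q b) =
      ∑ a, P a * ∑ b, (edgeInd G s(a, b) - d) * Q b := by
    refine sum_congr rfl fun a _ => ?_
    rw [mul_sum]
    exact sum_congr rfl fun b _ => by ring
  rw [h1]
  have h2 : ∑ a, (∑ b, (edgeInd G s(a, b) - d) * Q b) ^ 2 =
      ∑ b, ∑ c, Q b * Q c * ∑ a, (edgeInd G s(b, a) - d) * (edgeInd G s(c, a) - d) := by
    simp_rw [sq, sum_mul_sum, mul_sum]
    rw [sum_comm]
    refine sum_congr rfl fun b _ => ?_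
    rw [sum_comm]
    refine sum_congr rfl fun c _ => sum_congr rfl fun a _ => ?_
    rw [Sym2.eq_swap (a := b), Sym2.eq_swap (a := c)]
    ring
  have h3 : ∑ a, (∑ b, (edgeInd G s(a, b) - d) * Q b) ^ 2 ≤ 6 * ζ * n ^ 3 := by
    rw [h2]
    refine le_trans (sum_le_sum fun b _ => sum_le_sum fun c _ => ?_)
      (sum_abs_codegree_le hd0 hd1 hG hζ hn)
    refine (le_abs_self _).trans ?_
    rw [abs_mul, abs_mul]
    exact mul_le_of_le_one_left (abs_nonneg _)
      (mul_le_one₀ (hQ b) (abs_nonneg _) (hQ c))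
  calc (∑ a, P a * ∑ b, (edgeInd G s(a, b) - d) * Q b) ^ 2
      ≤ (∑ a, P a ^ 2) * ∑ a, (∑ b, (edgeInd G s(a, b) - d) * Q b) ^ 2 :=
        sum_mul_sq_le_sq_mul_sq _ _ _
    _ ≤ n * (6 * ζ * n ^ 3) := by
        refine mul_le_mul ?_ h3 (sum_nonneg fun _ _ => sq_nonneg _) (Nat.cast_nonneg _)
        have : ∀ a ∈ univ, P a ^ 2 ≤ 1 := fun a _ => (sq_le_one_iff_abs_le_one _).2 (hP a)
        simpa [hn'] using sum_le_card_nsmul _ _ _ this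
    _ = 6 * ζ * n ^ 4 := by ring

end Bilinear

section Rooted

variable {W V : Type*} [Fintype W] [Fintype V] [DecidableEq W] {S : Finset W} {ρ : W → V}

/-- The maps `W → V` which agree with `ρ` on the set `S` of roots. -/
def rootedMaps (S : Finset W) (ρ : W → V) : Finset (W → V) :=
  Fintype.piFinset fun x => if x ∈ S then {ρ x} else univ

lemma mem_rootedMaps {ψ : W → V} : ψ ∈ rootedMaps S ρ ↔ ∀ x ∈ S, ψ x = ρ x := by
  rw [rootedMaps, Fintype.mem_piFinset]
  refine forall_congr' fun x => ?_
  split_ifs with h <;> simp [h]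

lemma card_rootedMaps : #(rootedMaps S ρ) = Fintype.card V ^ (Fintype.card W - #S) := by
  rw [rootedMaps, Fintype.card_piFinset]
  have : ∀ x, #(if x ∈ S then {ρ x} else univ : Finset V) =
      if x ∈ Sᶜ then Fintype.card V else 1 := fun x => by
    by_cases h : x ∈ S <;> simp [h, card_univ]
  simp_rw [this, prod_ite_mem, prod_const, univ_inter, card_compl]

lemma update_mem_rootedMaps {ψ : W → V} (hψ : ψ ∈ rootedMaps S ρ) {x : W} (hx : x ∉ S) (a : V) :
    update ψ x a ∈ rootedMaps S ρ := by
  rw [mem_rootedMaps] at *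
  intro y hy
  rw [update_of_ne (ne_of_mem_of_not_mem hy hx), hψ y hy]

lemma sum_sum_update {x : W} (hx : x ∉ S) (g : (W → V) → ℝ) :
    ∑ ψ ∈ rootedMaps S ρ, ∑ a, g (update ψ x a) =
      Fintype.card V * ∑ ψ ∈ rootedMaps S ρ, g ψ := by
  rw [← sum_product' (f := fun ψ a => g (update ψ x a))]
  calc _ = ∑ p ∈ rootedMaps S ρ ×ˢ (univ : Finset V), g p.1 := by
        refine sum_nbij' (fun p => (update p.1 x p.2, p.1 x)) (fun p => (update p.1 x p.2, p.1 x))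
          ?_ ?_ ?_ ?_ ?_
        · exact fun p hp => mem_product.2
            ⟨update_mem_rootedMaps (mem_product.1 hp).1 hx _, mem_univ _⟩
        · exact fun p hp => mem_product.2
            ⟨update_mem_rootedMaps (mem_product.1 hp).1 hx _, mem_univ _⟩
        · simp
        · simp
        · simp
    _ = _ := by
        rw [sum_product, mul_sum]
        simp

lemma abs_sum_rootedMaps_le [Nonempty V] {x : W} (hx : x ∉ S) {g : (W → V) → ℝ} {K : ℝ}
    (h : ∀ ψ ∈ rootedMaps S ρ, |∑ a, g (update ψ x a)| ≤ K * Fintype.card V) :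
    |∑ ψ ∈ rootedMaps S ρ, g ψ| ≤ K * #(rootedMaps S ρ) := by
  have hn : (0 : ℝ) < Fintype.card V := by exact_mod_cast Fintype.card_pos
  refine le_of_mul_le_mul_left ?_ hn
  calc Fintype.card V * |∑ ψ ∈ rootedMaps S ρ, g ψ|
      = |∑ ψ ∈ rootedMaps S ρ, ∑ a, g (update ψ x a)| := by
        rw [sum_sum_update hx, abs_mul, Nat.abs_cast]
    _ ≤ ∑ ψ ∈ rootedMaps S ρ, |∑ a, g (update ψ x a)| := abs_sum_le_sum_abs _ _
    _ ≤ ∑ ψ ∈ rootedMaps S ρ, K * Fintype.card V := sum_le_sum h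
    _ = _ := by rw [sum_const, nsmul_eq_mul]; ring

lemma abs_sum_rootedMaps_le₂ [Nonempty V] {x y : W} (hx : x ∉ S) (hy : y ∉ S)
    {g : (W → V) → ℝ} {K : ℝ}
    (h : ∀ ψ ∈ rootedMaps S ρ,
      |∑ a, ∑ b, g (update (update ψ x a) y b)| ≤ K * (Fintype.card V : ℝ) ^ 2) :
    |∑ ψ ∈ rootedMaps S ρ, g ψ| ≤ K * #(rootedMaps S ρ) := by
  have hn : (0 : ℝ) < Fintype.card V := by exact_mod_cast Fintype.card_pos
  refine le_of_mul_le_mul_left ?_ hn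
  have := abs_sum_rootedMaps_le (S := S) (ρ := ρ) hx (g := fun ψ => ∑ b, g (update ψ y b))
    (K := K * Fintype.card V) fun ψ hψ => (h ψ hψ).trans_eq (by ring)
  rw [sum_sum_update hy, abs_mul, Nat.abs_cast] at this
  linarith

/-- A family of rooted maps is small if fixing all but one coordinate leaves few choices. -/
lemma card_filter_rootedMaps_le [Nonempty V] {x : W} (hx : x ∉ S) {p : (W → V) → Prop}
    [DecidablePred p] {K : ℝ}
    (h : ∀ ψ ∈ rootedMaps S ρ,
      ({a | p (update ψ x a)} : Set V).ncard ≤ K * Fintype.card V) :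
    (#{ψ ∈ rootedMaps S ρ | p ψ} : ℝ) ≤ K * #(rootedMaps S ρ) := by
  have := abs_sum_rootedMaps_le (S := S) (ρ := ρ) hx (g := fun ψ => if p ψ then 1 else 0) (K := K)
    fun ψ hψ => by
      rw [sum_boole, Nat.abs_cast]
      refine le_of_eq_of_le ?_ (h ψ hψ)
      rw [← Set.ncard_coe_finset]
      simp
  rwa [sum_boole, Nat.abs_cast] at this

end Rooted

section HomCount

variable {W V : Type*} [Fintype W] [Fintype V] [DecidableEq W] {S : Finset W} {ρ : W → V}
  {G : SimpleGraph V} {F : SimpleGraph W} {d δ : ℝ}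

/-- The number of maps extending the roots which map all of `E` to edges of `G`. -/
noncomputable def homSum (G : SimpleGraph V) (S : Finset W) (ρ : W → V) (E : Finset (Sym2 W)) : ℝ :=
  ∑ ψ ∈ rootedMaps S ρ, ∏ e ∈ E, edgeInd G (e.map ψ)

omit [Fintype W] [Fintype V] in
lemma map_update_of_notMem {ψ : W → V} {x : W} {e : Sym2 W} (h : x ∉ e) (a : V) :
    e.map (update ψ x a) = e.map ψ :=
  Sym2.map_congr fun _ hy => update_of_ne (ne_of_mem_of_not_mem hy h) _ _

lemma abs_homSum_insert_sub_le [Nonempty V] {x y : W} (hx : x ∉ S) (hy : y ∉ S) (hxy : x ≠ y)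
    {J : Finset (Sym2 W)} (hJ : s(x, y) ∉ J)
    (hdisc : ∀ P Q : V → ℝ, (∀ a, |P a| ≤ 1) → (∀ a, |Q a| ≤ 1) →
      |∑ a, ∑ b, (edgeInd G s(a, b) - d) * (P a * Q b)| ≤ δ * (Fintype.card V : ℝ) ^ 2) :
    |homSum G S ρ (insert s(x, y) J) - d * homSum G S ρ J| ≤ δ * #(rootedMaps S ρ) := by
  rw [homSum, homSum, mul_sum, ← sum_sub_distrib]
  refine abs_sum_rootedMaps_le₂ hx hy fun ψ _ => ?_
  have key := hdisc (fun a => ∏ e ∈ J with y ∉ e, edgeInd G (e.map (update ψ x a)))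
    (fun b => ∏ e ∈ J with ¬ y ∉ e, edgeInd G (e.map (update ψ y b)))
    (fun _ => abs_prod_edgeInd_le_one _ _) (fun _ => abs_prod_edgeInd_le_one _ _)
  convert key using 5 with a _ b _
  rw [prod_insert hJ, ← sub_mul]
  congr 1
  · simp [hxy]
  · rw [← prod_filter_mul_prod_filter_not J (fun e => y ∉ e)]
    congr 1
    · exact prod_congr rfl fun e he => by rw [map_update_of_notMem (mem_filter.1 he).2]
    · refine prod_congr rfl fun e he => ?_
      have hye : y ∈ e := not_not.1 (mem_filter.1 he).2
      have hxe : x ∉ e := fun hxe => hJ <| by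
        rw [← (Sym2.mem_and_mem_iff hxy).1 ⟨hxe, hye⟩]
        exact (mem_filter.1 he).1
      rw [update_comm hxy, map_update_of_notMem hxe]

lemma abs_homSum_star_sub_le [Nonempty V] {z : W} (hz : z ∉ S) {K : Finset W} (hK : K ⊆ S)
    {J : Finset (Sym2 W)} (hJ : ∀ e ∈ J, z ∉ e)
    (hstar : |∑ a, ∏ s ∈ K, edgeInd G s(ρ s, a) - d ^ #K * Fintype.card V| ≤
      δ * Fintype.card V) :
    |homSum G S ρ (K.image (fun s => s(s, z)) ∪ J) - d ^ #K * homSum G S ρ J| ≤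
      δ * #(rootedMaps S ρ) := by
  rw [homSum, homSum, mul_sum, ← sum_sub_distrib]
  refine abs_sum_rootedMaps_le hz fun ψ hψ => ?_
  have hdisj : Disjoint (K.image (fun s => s(s, z))) J := by
    rw [disjoint_left]
    intro e he heJ
    obtain ⟨s, _, rfl⟩ := mem_image.1 he
    exact hJ _ heJ (Sym2.mem_mk_right _ _)
  have hinj : Set.InjOn (fun s => s(s, z)) (K : Set W) := by
    exact fun _ _ _ _ h => Sym2.congr_left.1 h
  have h : ∀ a, (∏ e ∈ K.image (fun s => s(s, z)) ∪ J, edgeInd G (e.map (update ψ z a))) -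
      d ^ #K * ∏ e ∈ J, edgeInd G (e.map (update ψ z a)) =
      (∏ s ∈ K, edgeInd G s(ρ s, a) - d ^ #K) * ∏ e ∈ J, edgeInd G (e.map ψ) := by
    intro a
    rw [prod_union hdisj, prod_image hinj, ← sub_mul]
    congr 1
    · congr 1
      refine prod_congr rfl fun s hs => ?_
      have hsz : s ≠ z := ne_of_mem_of_not_mem (hK hs) hz
      simp [update_of_ne hsz, mem_rootedMaps.1 hψ s (hK hs)]
    · exact prod_congr rfl fun e he => by rw [map_update_of_notMem (hJ e he)]
  simp_rw [h]
  rw [← sum_mul, sum_sub_distrib, sum_const, card_univ, nsmul_eq_mul, mul_comm _ (d ^ #K), abs_mul]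
  exact (mul_le_of_le_one_right (abs_nonneg _) (abs_prod_edgeInd_le_one _ _)).trans hstar

/-- Counting lemma for (not necessarily injective) rooted homomorphisms. -/
theorem abs_homSum_sub_le [Nonempty V] (hd0 : 0 ≤ d) (hd1 : d ≤ 1) (hδ : 0 ≤ δ)
    (hdisc : ∀ P Q : V → ℝ, (∀ a, |P a| ≤ 1) → (∀ a, |Q a| ≤ 1) →
      |∑ a, ∑ b, (edgeInd G s(a, b) - d) * (P a * Q b)| ≤ δ * (Fintype.card V : ℝ) ^ 2)
    (hstar : ∀ z ∉ S, ∀ K ⊆ S, (∀ s ∈ K, F.Adj s z) →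
      |∑ a, ∏ s ∈ K, edgeInd G s(ρ s, a) - d ^ #K * Fintype.card V| ≤ δ * Fintype.card V)
    (E : Finset (Sym2 W)) (hEF : ∀ e ∈ E, e ∈ F.edgeSet) (hES : ∀ e ∈ E, ∃ z ∈ e, z ∉ S) :
    |homSum G S ρ E - d ^ #E * #(rootedMaps S ρ)| ≤ #E * (δ * #(rootedMaps S ρ)) := by
  induction hm : #E using Nat.strong_induction_on generalizing E with
  | _ m ih =>
  have step : ∀ B J : Finset (Sym2 W), B ∪ J = E → Disjoint B J → B.Nonempty →
      |homSum G S ρ (B ∪ J) - d ^ #B * homSum G S ρ J| ≤ δ * #(rootedMaps S ρ) →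
      |homSum G S ρ E - d ^ m * #(rootedMaps S ρ)| ≤ m * (δ * #(rootedMaps S ρ)) := by
    intro B J hBJ hdisj hB hpeel
    have hcard : #B + #J = m := by rw [← card_union_of_disjoint hdisj, hBJ, hm]
    have hBpos := hB.card_pos
    have hJE : J ⊆ E := hBJ ▸ subset_union_right
    have hJ := ih #J (by omega) J (fun e he => hEF e (hJE he)) (fun e he => hES e (hJE he)) rfl
    rw [hBJ] at hpeel
    have h1 : |d ^ #B * (homSum G S ρ J - d ^ #J * #(rootedMaps S ρ))| ≤
        #J * (δ * #(rootedMaps S ρ)) := by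
      rw [abs_mul, abs_of_nonneg (pow_nonneg hd0 _)]
      exact (mul_le_of_le_one_left (abs_nonneg _) (pow_le_one₀ hd0 hd1)).trans hJ
    have h2 : ((#J : ℝ) + 1) * (δ * #(rootedMaps S ρ)) ≤ m * (δ * #(rootedMaps S ρ)) := by
      refine mul_le_mul_of_nonneg_right ?_ (by positivity)
      exact_mod_cast (by omega : #J + 1 ≤ m)
    calc _ = |(homSum G S ρ E - d ^ #B * homSum G S ρ J) +
          d ^ #B * (homSum G S ρ J - d ^ #J * #(rootedMaps S ρ))| := by
          rw [← hcard, pow_add]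
          congr 1
          ring
      _ ≤ _ := (abs_add_le _ _).trans (by linarith)
  by_cases hinner : ∃ e ∈ E, ∀ z ∈ e, z ∉ S
  · obtain ⟨e, he, heS⟩ := hinner
    induction e with | h x y =>
    have hxy : x ≠ y := F.ne_of_adj (hEF _ he)
    refine step {s(x, y)} (E.erase s(x, y)) ?_ ?_ (singleton_nonempty _) ?_
    · rw [← insert_eq, insert_erase he]
    · simp
    · rw [← insert_eq, card_singleton, pow_one]
      exact abs_homSum_insert_sub_le (heS x (by simp)) (heS y (by simp)) hxy (by simp) hdisc
  rcases E.eq_empty_or_nonempty with rfl | ⟨e, he⟩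
  · simp only [card_empty] at hm
    simp [homSum, ← hm]
  obtain ⟨z, hze, hz⟩ := hES e he
  set K : Finset W := {s ∈ S | s(s, z) ∈ E} with hKdef
  have hinj : Set.InjOn (fun s => s(s, z)) (K : Set W) := by
    exact fun _ _ _ _ h => Sym2.congr_left.1 h
  have himage : K.image (fun s => s(s, z)) = {e ∈ E | z ∈ e} := by
    ext e'
    simp only [mem_image, mem_filter, hKdef]
    constructor
    · rintro ⟨s, ⟨_, hs⟩, rfl⟩
      exact ⟨hs, Sym2.mem_mk_right _ _⟩
    · rintro ⟨he', hz'⟩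
      obtain ⟨s, rfl⟩ := Sym2.mem_iff_exists.1 hz'
      rw [Sym2.eq_swap] at he' ⊢
      refine ⟨s, ⟨?_, he'⟩, rfl⟩
      by_contra hs
      refine hinner ⟨_, he', fun w hw => ?_⟩
      rcases Sym2.mem_iff.1 hw with rfl | rfl <;> assumption
  refine step (K.image fun s => s(s, z)) {e ∈ E | z ∉ e} ?_ ?_ ?_ ?_
  · rw [himage, filter_union_filter_not_eq]
  · rw [himage]
    exact disjoint_filter_filter_not _ _ _
  · rw [himage]
    exact ⟨e, mem_filter.2 ⟨he, hze⟩⟩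
  · rw [card_image_of_injOn hinj]
    exact abs_homSum_star_sub_le hz (filter_subset _ _) (fun e he => (mem_filter.1 he).2)
      (hstar z hz K (filter_subset _ _) fun s hs => hEF _ (mem_filter.1 hs).2)

end HomCount

section Rainbow

variable {W V : Type*} {G : SimpleGraph V} {F : SimpleGraph W} {φ : Sym2 V → ℕ}

/-- `ψ` is an injective homomorphism from `F` to `G` whose image is rainbow. -/
def IsRainbowEmbedding (F : SimpleGraph W) (G : SimpleGraph V) (φ : Sym2 V → ℕ) (ψ : W → V) :
    Prop :=
  Injective ψ ∧ (∀ e ∈ F.edgeSet, e.map ψ ∈ G.edgeSet) ∧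
    Set.InjOn (fun e => φ (e.map ψ)) F.edgeSet

variable [Fintype W] [Fintype V] [DecidableEq W] {S : Finset W} {ρ : W → V} {d δ : ℝ}

open Classical in
lemma homSum_eq_card
    (hS : ∀ e ∈ F.edgeSet, (∀ z ∈ e, z ∈ S) → e.map ρ ∈ G.edgeSet) :
    homSum G S ρ {e ∈ F.edgeFinset | ∃ z ∈ e, z ∉ S} =
      #{ψ ∈ rootedMaps S ρ | ∀ e ∈ F.edgeSet, e.map ψ ∈ G.edgeSet} := by
  rw [homSum, ← sum_boole]
  refine sum_congr rfl fun ψ hψ => ?_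
  split_ifs with h
  · refine prod_eq_one fun e he => ?_
    exact Set.indicator_of_mem (h e (SimpleGraph.mem_edgeFinset.1 (mem_filter.1 he).1)) _
  · push Not at h
    obtain ⟨e, he, heG⟩ := h
    refine prod_eq_zero (i := e) (mem_filter.2 ⟨SimpleGraph.mem_edgeFinset.2 he, ?_⟩)
      (Set.indicator_of_notMem heG _)
    by_contra! hz
    refine heG ?_
    rw [Sym2.map_congr fun z hze => mem_rootedMaps.1 hψ z (hz z hze)]
    exact hS e he hz

open Classical in
lemma card_filter_eq_le [Nonempty V] (hρ : Set.InjOn ρ S) (hn : 1 ≤ δ * Fintype.card V)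
    {x y : W} (hxy : x ≠ y) :
    (#{ψ ∈ rootedMaps S ρ | ψ x = ψ y} : ℝ) ≤ δ * #(rootedMaps S ρ) := by
  have key : ∀ x y : W, x ≠ y → x ∉ S →
      (#{ψ ∈ rootedMaps S ρ | ψ x = ψ y} : ℝ) ≤ δ * #(rootedMaps S ρ) := by
    intro x y hxy hx
    refine card_filter_rootedMaps_le hx fun ψ _ => ?_
    simpa [update_of_ne hxy.symm] using hn
  by_cases hx : x ∈ S
  · by_cases hy : y ∈ S
    · have : {ψ ∈ rootedMaps S ρ | ψ x = ψ y} = ∅ := by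
        refine filter_eq_empty_iff.2 fun ψ hψ h => hxy (hρ hx hy ?_)
        rw [← mem_rootedMaps.1 hψ x hx, ← mem_rootedMaps.1 hψ y hy, h]
      have hδ : 0 ≤ δ := le_of_not_gt fun h => by
        have := mul_nonpos_of_nonpos_of_nonneg h.le (Nat.cast_nonneg (α := ℝ) (Fintype.card V))
        linarith
      rw [this, card_empty, Nat.cast_zero]
      positivity
    · rw [filter_congr fun ψ _ => eq_comm (a := ψ x)]
      exact key y x hxy.symm hy
  · exact key x y hxy hx

open Classical in
lemma card_filter_colour_eq_le_of_mem [Nonempty V] (hφ : LBounded G φ (δ * Fintype.card V))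
    {e₁ e₂ : Sym2 W} (he₂ : e₂ ∈ F.edgeSet) {x : W} (hx₁ : x ∉ e₁) (hx₂ : x ∈ e₂) (hx : x ∉ S) :
    (#{ψ ∈ rootedMaps S ρ | (∀ e ∈ F.edgeSet, e.map ψ ∈ G.edgeSet) ∧
      φ (e₁.map ψ) = φ (e₂.map ψ)} : ℝ) ≤ δ * #(rootedMaps S ρ) := by
  obtain ⟨y, rfl⟩ := Sym2.mem_iff_exists.1 hx₂
  have hxy : y ≠ x := (F.ne_of_adj he₂).symm
  refine card_filter_rootedMaps_le hx fun ψ _ => ?_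
  refine le_trans ?_ (hφ (ψ y) (φ (e₁.map ψ)))
  refine Nat.cast_le.2 (Set.ncard_le_ncard ?_ (Set.toFinite _))
  rintro a ⟨hhom, hcol⟩
  have := hhom _ he₂
  rw [map_update_of_notMem hx₁] at hcol
  rw [Sym2.map_mk, update_self, update_of_ne hxy, Sym2.eq_swap] at hcol this
  exact ⟨this, hcol.symm⟩

open Classical in
lemma card_filter_colour_eq_le [Nonempty V] (hφ : LBounded G φ (δ * Fintype.card V))
    (huniq : ∀ e₁ ∈ F.edgeSet, ∀ e₂ ∈ F.edgeSet, (∀ z ∈ e₁, z ∈ S) → (∀ z ∈ e₂, z ∈ S) → e₁ = e₂)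
    (hmono : ∀ z ∉ S, ∀ s ∈ S, ∀ t ∈ S, s ≠ t → F.Adj s z → F.Adj t z →
      (monoCodeg G φ (ρ s) (ρ t) : ℝ) ≤ δ * Fintype.card V)
    {e₁ e₂ : Sym2 W} (he₁ : e₁ ∈ F.edgeSet) (he₂ : e₂ ∈ F.edgeSet) (hne : e₁ ≠ e₂) :
    (#{ψ ∈ rootedMaps S ρ | (∀ e ∈ F.edgeSet, e.map ψ ∈ G.edgeSet) ∧
      φ (e₁.map ψ) = φ (e₂.map ψ)} : ℝ) ≤ δ * #(rootedMaps S ρ) := by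
  by_cases h₁ : ∃ x ∈ e₂, x ∉ e₁ ∧ x ∉ S
  · obtain ⟨x, hx₂, hx₁, hx⟩ := h₁
    exact card_filter_colour_eq_le_of_mem hφ he₂ hx₁ hx₂ hx
  by_cases h₂ : ∃ x ∈ e₁, x ∉ e₂ ∧ x ∉ S
  · obtain ⟨x, hx₁, hx₂, hx⟩ := h₂
    simp_rw [eq_comm (a := φ (e₁.map _))]
    exact card_filter_colour_eq_le_of_mem hφ he₁ hx₂ hx₁ hx
  have h₃ : ∃ z ∈ e₁, z ∉ S := by
    by_contra! h
    refine hne (huniq e₁ he₁ e₂ he₂ h fun z hz => ?_)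
    by_contra hzS
    exact h₁ ⟨z, hz, fun hz' => hzS (h z hz'), hzS⟩
  obtain ⟨z, hz₁, hz⟩ := h₃
  have hz₂ : z ∈ e₂ := by
    by_contra hz₂
    exact h₂ ⟨z, hz₁, hz₂, hz⟩
  obtain ⟨s, rfl⟩ := Sym2.mem_iff_exists.1 hz₁
  obtain ⟨t, rfl⟩ := Sym2.mem_iff_exists.1 hz₂
  have hst : s ≠ t := fun h => hne (by rw [h])
  have hzs : s ≠ z := (F.ne_of_adj he₁).symm
  have hzt : t ≠ z := (F.ne_of_adj he₂).symm
  have hs : s ∈ S := by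
    by_contra hs
    exact h₂ ⟨s, by simp, by simp [hst, hzs], hs⟩
  have ht : t ∈ S := by
    by_contra ht
    exact h₁ ⟨t, by simp, by simp [hst.symm, hzt], ht⟩
  refine card_filter_rootedMaps_le hz fun ψ hψ => ?_
  refine le_trans ?_ (hmono z hz s hs t ht hst he₁.symm he₂.symm)
  refine Nat.cast_le.2 (Set.ncard_le_ncard ?_ (Set.toFinite _))
  rintro a ⟨hhom, hcol⟩
  have h1 := hhom _ he₁
  have h2 := hhom _ he₂
  simp only [Sym2.map_mk, update_self, update_of_ne hzs, update_of_ne hzt,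
    mem_rootedMaps.1 hψ s hs, mem_rootedMaps.1 hψ t ht] at h1 h2 hcol
  rw [Sym2.eq_swap, Sym2.eq_swap (a := a)] at hcol
  exact ⟨h1.symm, h2.symm, hcol⟩

open Classical in
/-- Counting lemma for rooted rainbow embeddings. -/
theorem abs_card_rainbowEmbedding_sub_le [Nonempty V] (hd0 : 0 ≤ d) (hd1 : d ≤ 1) (hδ : 0 ≤ δ)
    (hdisc : ∀ P Q : V → ℝ, (∀ a, |P a| ≤ 1) → (∀ a, |Q a| ≤ 1) →
      |∑ a, ∑ b, (edgeInd G s(a, b) - d) * (P a * Q b)| ≤ δ * (Fintype.card V : ℝ) ^ 2)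
    (hstar : ∀ z ∉ S, ∀ K ⊆ S, (∀ s ∈ K, F.Adj s z) →
      |∑ a, ∏ s ∈ K, edgeInd G s(ρ s, a) - d ^ #K * Fintype.card V| ≤ δ * Fintype.card V)
    (hρ : Set.InjOn ρ S) (hn : 1 ≤ δ * Fintype.card V)
    (hφ : LBounded G φ (δ * Fintype.card V))
    (hS : ∀ e ∈ F.edgeSet, (∀ z ∈ e, z ∈ S) → e.map ρ ∈ G.edgeSet)
    (huniq : ∀ e₁ ∈ F.edgeSet, ∀ e₂ ∈ F.edgeSet, (∀ z ∈ e₁, z ∈ S) → (∀ z ∈ e₂, z ∈ S) → e₁ = e₂)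
    (hmono : ∀ z ∉ S, ∀ s ∈ S, ∀ t ∈ S, s ≠ t → F.Adj s z → F.Adj t z →
      (monoCodeg G φ (ρ s) (ρ t) : ℝ) ≤ δ * Fintype.card V) :
    |(#{ψ ∈ rootedMaps S ρ | IsRainbowEmbedding F G φ ψ} : ℝ) -
        d ^ #{e ∈ F.edgeFinset | ∃ z ∈ e, z ∉ S} * #(rootedMaps S ρ)| ≤
      (#F.edgeFinset + (Fintype.card W : ℝ) ^ 2 + (#F.edgeFinset : ℝ) ^ 2) *
        (δ * #(rootedMaps S ρ)) := by
  set M := rootedMaps S ρ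
  set E : Finset (Sym2 W) := {e ∈ F.edgeFinset | ∃ z ∈ e, z ∉ S} with hE
  set X : Finset (W → V) := {ψ ∈ M | ∀ e ∈ F.edgeSet, e.map ψ ∈ G.edgeSet}
  set R : Finset (W → V) := {ψ ∈ M | IsRainbowEmbedding F G φ ψ}
  set B₁ : Finset (W → V) := (univ : Finset W).offDiag.biUnion fun p => {ψ ∈ M | ψ p.1 = ψ p.2}
  set B₂ : Finset (W → V) := F.edgeFinset.offDiag.biUnion fun p =>
    {ψ ∈ M | (∀ e ∈ F.edgeSet, e.map ψ ∈ G.edgeSet) ∧ φ (p.1.map ψ) = φ (p.2.map ψ)}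
  have hN : 0 ≤ δ * #M := by positivity
  have hom : |(#X : ℝ) - d ^ #E * #M| ≤ #E * (δ * #M) := by
    have := abs_homSum_sub_le hd0 hd1 hδ hdisc hstar E
      (fun e he => SimpleGraph.mem_edgeFinset.1 (mem_filter.1 he).1)
      (fun e he => (mem_filter.1 he).2)
    rwa [hE, homSum_eq_card hS] at this
  have hRX : R ⊆ X := fun ψ hψ =>
    mem_filter.2 ⟨(mem_filter.1 hψ).1, (mem_filter.1 hψ).2.2.1⟩
  have hXR : X ⊆ R ∪ (B₁ ∪ B₂) := by
    intro ψ hψ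
    obtain ⟨hψM, hhom⟩ := mem_filter.1 hψ
    by_cases hinj : Injective ψ
    · by_cases hrain : Set.InjOn (fun e => φ (e.map ψ)) F.edgeSet
      · exact mem_union_left _ (mem_filter.2 ⟨hψM, hinj, hhom, hrain⟩)
      · refine mem_union_right _ (mem_union_right _ ?_)
        simp only [Set.InjOn, not_forall] at hrain
        obtain ⟨e₁, he₁, e₂, he₂, hcol, hne⟩ := hrain
        exact mem_biUnion.2 ⟨(e₁, e₂), by simpa using ⟨he₁, he₂, hne⟩,
          mem_filter.2 ⟨hψM, hhom, hcol⟩⟩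
    · refine mem_union_right _ (mem_union_left _ ?_)
      simp only [Injective, not_forall] at hinj
      obtain ⟨x, y, hxy, hne⟩ := hinj
      exact mem_biUnion.2 ⟨(x, y), by simpa using hne, mem_filter.2 ⟨hψM, hxy⟩⟩
  have hB₁ : (#B₁ : ℝ) ≤ (Fintype.card W : ℝ) ^ 2 * (δ * #M) := by
    calc (#B₁ : ℝ) ≤ ∑ p ∈ (univ : Finset W).offDiag, (#{ψ ∈ M | ψ p.1 = ψ p.2} : ℝ) := by
          exact_mod_cast card_biUnion_le
      _ ≤ ∑ p ∈ (univ : Finset W).offDiag, δ * #M :=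
          sum_le_sum fun p hp => card_filter_eq_le hρ hn (mem_offDiag.1 hp).2.2
      _ ≤ _ := by
          rw [sum_const, nsmul_eq_mul]
          refine mul_le_mul_of_nonneg_right ?_ hN
          rw [offDiag_card, card_univ, sq]
          exact_mod_cast Nat.sub_le _ _
  have hB₂ : (#B₂ : ℝ) ≤ (#F.edgeFinset : ℝ) ^ 2 * (δ * #M) := by
    calc (#B₂ : ℝ) ≤ ∑ p ∈ F.edgeFinset.offDiag,
          (#{ψ ∈ M | (∀ e ∈ F.edgeSet, e.map ψ ∈ G.edgeSet) ∧
            φ (p.1.map ψ) = φ (p.2.map ψ)} : ℝ) := by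
          exact_mod_cast card_biUnion_le
      _ ≤ ∑ p ∈ F.edgeFinset.offDiag, δ * #M :=
          sum_le_sum fun p hp => by
            obtain ⟨h1, h2, h3⟩ := mem_offDiag.1 hp
            exact card_filter_colour_eq_le hφ huniq hmono (SimpleGraph.mem_edgeFinset.1 h1)
              (SimpleGraph.mem_edgeFinset.1 h2) h3
      _ ≤ _ := by
          rw [sum_const, nsmul_eq_mul]
          refine mul_le_mul_of_nonneg_right ?_ hN
          rw [offDiag_card, sq]
          exact_mod_cast Nat.sub_le _ _
  have hle : (#R : ℝ) ≤ #X := by exact_mod_cast card_le_card hRX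
  have hge : (#X : ℝ) ≤ #R + (#B₁ + #B₂) := by
    exact_mod_cast (card_le_card hXR).trans
      ((card_union_le _ _).trans (Nat.add_le_add_left (card_union_le _ _) _))
  have hEF : (#E : ℝ) * (δ * #M) ≤ #F.edgeFinset * (δ * #M) :=
    mul_le_mul_of_nonneg_right (by exact_mod_cast card_le_card (filter_subset _ _)) hN
  rw [abs_le] at hom ⊢
  constructor <;> nlinarith [hom.1, hom.2]

end Rainbow

section Copies

open SimpleGraph

variable {W V : Type*} {G : SimpleGraph V} {F : SimpleGraph W} {φ : Sym2 V → ℕ}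

/-- The copy of `F` in `G` given by an isomorphism from `F` to a subgraph of `G`. -/
def copyOfIso {H : G.Subgraph} (e : F ≃g H.coe) : Copy F G :=
  ⟨H.hom.comp e.toHom, Subgraph.hom_injective.comp e.injective⟩

lemma toSubgraph_copyOfIso {H : G.Subgraph} (e : F ≃g H.coe) : (copyOfIso e).toSubgraph = H := by
  simp [copyOfIso, Copy.toSubgraph, Subgraph.map_comp]

lemma copyOfIso_injective {H : G.Subgraph} :
    Injective (copyOfIso : (F ≃g H.coe) → Copy F G) := by
  intro e e' h
  ext a
  exact DFunLike.congr_fun h a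

lemma copyOfIso_isoToSubgraph (c : Copy F G) : copyOfIso c.isoToSubgraph = c := by
  ext a
  rfl

instance [Finite W] [Finite V] : Finite (Copy F G) :=
  DFunLike.finite _

/-- Every copy of `F` is the image of exactly `|Aut(F)|` embeddings. -/
lemma card_copy_eq [Finite W] [Finite V] (P : G.Subgraph → Prop) :
    Nat.card {c : Copy F G // Rainbow φ c.toSubgraph.edgeSet ∧ P c.toSubgraph} =
      rCountQ F G φ P * Nat.card (F ≃g F) := by
  classical
  let X := {H : G.Subgraph // Rainbow φ H.edgeSet ∧ P H ∧ Nonempty (F ≃g H.coe)}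
  have : Fintype X := Fintype.ofFinite X
  let g : (Σ H : X, F ≃g H.1.coe) →
      {c : Copy F G // Rainbow φ c.toSubgraph.edgeSet ∧ P c.toSubgraph} :=
    fun p => ⟨copyOfIso p.2, by
      rw [toSubgraph_copyOfIso]
      exact ⟨p.1.2.1, p.1.2.2.1⟩⟩
  have hg : Bijective g := by
    constructor
    · rintro ⟨⟨H, hH⟩, e⟩ ⟨⟨H', hH'⟩, e'⟩ h
      have h : copyOfIso e = copyOfIso e' := congrArg Subtype.val h
      obtain rfl : H = H' := by
        have h' := congrArg Copy.toSubgraph h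
        rwa [toSubgraph_copyOfIso, toSubgraph_copyOfIso] at h'
      obtain rfl := copyOfIso_injective h
      rfl
    · rintro ⟨c, hc⟩
      exact ⟨⟨⟨c.toSubgraph, hc.1, hc.2, ⟨c.isoToSubgraph⟩⟩, c.isoToSubgraph⟩,
        Subtype.ext (copyOfIso_isoToSubgraph c)⟩
  have hfin : ∀ H : X, Finite (F ≃g H.1.coe) := fun H => DFunLike.finite _
  rw [← Nat.card_eq_of_bijective g hg, Nat.card_sigma]
  have hfibre : ∀ H : X, Nat.card (F ≃g H.1.coe) = Nat.card (F ≃g F) := by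
    intro H
    obtain ⟨e₀⟩ := H.2.2.2
    exact Nat.card_congr
      { toFun := fun e => e.trans e₀.symm
        invFun := fun e => e.trans e₀
        left_inv := fun e => by ext a; simp
        right_inv := fun e => by ext a; simp }
  rw [sum_congr rfl fun H _ => hfibre H, sum_const, smul_eq_mul, card_univ,
    ← Nat.card_eq_fintype_card, rCountQ, ← Nat.card_coe_set_eq]
  rfl

lemma edgeSet_toSubgraph (c : Copy F G) : c.toSubgraph.edgeSet = Sym2.map c '' F.edgeSet := by
  simp [Copy.toSubgraph, Subgraph.edgeSet_map]

lemma rainbow_toSubgraph_iff (c : Copy F G) :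
    Rainbow φ c.toSubgraph.edgeSet ↔ Set.InjOn (fun e => φ (e.map c)) F.edgeSet := by
  rw [edgeSet_toSubgraph, Rainbow]
  constructor
  · exact fun h => h.comp (Sym2.map.injective c.injective).injOn (Set.mapsTo_image _ _)
  · rintro h _ ⟨e, he, rfl⟩ _ ⟨e', he', rfl⟩ hee'
    rw [h he he' hee']

open Classical in
lemma card_copy_eq_card_rainbowEmbedding [Fintype W] [Fintype V] {P : G.Subgraph → Prop}
    {Q : (W → V) → Prop} (hPQ : ∀ c : Copy F G, P c.toSubgraph ↔ Q c) :
    Nat.card {c : Copy F G // Rainbow φ c.toSubgraph.edgeSet ∧ P c.toSubgraph} =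
      #{ψ : W → V | Q ψ ∧ IsRainbowEmbedding F G φ ψ} := by
  have e : {c : Copy F G // Rainbow φ c.toSubgraph.edgeSet ∧ P c.toSubgraph} ≃
      {ψ : W → V // Q ψ ∧ IsRainbowEmbedding F G φ ψ} :=
    { toFun := fun c => ⟨c.1, (hPQ _).1 c.2.2, c.1.injective,
        fun e he => (c.1.mapEdgeSet ⟨e, he⟩).2, (rainbow_toSubgraph_iff _).1 c.2.1⟩
      invFun := fun ψ => ⟨⟨⟨ψ.1, fun {a b} h => ψ.2.2.2.1 s(a, b) h⟩, ψ.2.2.1⟩,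
        (rainbow_toSubgraph_iff _).2 ψ.2.2.2.2, (hPQ _).2 ψ.2.1⟩
      left_inv := fun _ => rfl
      right_inv := fun _ => rfl }
  rw [Nat.card_congr e, Nat.card_eq_fintype_card, Fintype.card_subtype]

open Classical in
lemma rCountQ_vertex [Fintype W] [DecidableEq W] [Fintype V] (u : V) :
    rCountQ F G φ (fun H => u ∈ H.verts) * Nat.card (F ≃g F) =
      ∑ x : W, #{ψ ∈ rootedMaps {x} (fun _ => u) | IsRainbowEmbedding F G φ ψ} := by
  rw [← card_copy_eq, card_copy_eq_card_rainbowEmbedding (P := fun H => u ∈ H.verts)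
    (Q := fun ψ => ∃ x, ψ x = u)
    (fun c => by simp [Copy.toSubgraph]), ← card_biUnion]
  · congr 1
    ext ψ
    simp [mem_rootedMaps]
  · intro x _ y _ hxy
    refine Finset.disjoint_left.2 fun ψ hx hy => ?_
    simp only [mem_filter, mem_rootedMaps, mem_singleton, forall_eq] at hx hy
    exact hxy (hx.2.1 (hx.1.trans hy.1.symm))

open Classical in
lemma rCountQ_edge [Fintype W] [DecidableEq W] [Fintype V] {v w : V} :
    rCountQ F G φ (fun H => s(v, w) ∈ H.edgeSet) * Nat.card (F ≃g F) =
      ∑ D : F.Dart, #{ψ ∈ rootedMaps {D.fst, D.snd} (fun z => if z = D.fst then v else w) |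
        IsRainbowEmbedding F G φ ψ} := by
  have hroot : ∀ (D : F.Dart) (ψ : W → V),
      ψ ∈ rootedMaps {D.fst, D.snd} (fun z => if z = D.fst then v else w) ↔
        ψ D.fst = v ∧ ψ D.snd = w := by
    intro D ψ
    simp [mem_rootedMaps, D.adj.ne']
  rw [← card_copy_eq, card_copy_eq_card_rainbowEmbedding
    (P := fun H => s(v, w) ∈ H.edgeSet)
    (Q := fun ψ => ∃ D : F.Dart, ψ D.fst = v ∧ ψ D.snd = w) ?_, ← card_biUnion]
  · congr 1
    ext ψ
    simp [hroot]
  · intro D _ D' _ hD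
    refine Finset.disjoint_left.2 fun ψ hx hy => ?_
    rw [mem_filter, hroot] at hx hy
    exact hD (Dart.ext _ _ (Prod.ext (hx.2.1 (hx.1.1.trans hy.1.1.symm))
      (hx.2.1 (hx.1.2.trans hy.1.2.symm))))
  · intro c
    simp only [Subgraph.mem_edgeSet, Subgraph.map_adj, Relation.Map, Subgraph.top_adj]
    constructor
    · rintro ⟨x, y, hxy, hx, hy⟩
      exact ⟨⟨(x, y), hxy⟩, hx, hy⟩
    · rintro ⟨D, hx, hy⟩
      exact ⟨D.fst, D.snd, D.adj, hx, hy⟩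

end Copies

section Count

variable {W V : Type*} [Fintype W] [Fintype V] [DecidableEq W] {G : SimpleGraph V}
  {F : SimpleGraph W} {φ : Sym2 V → ℕ} {d δ ζ : ℝ}

lemma abs_discrepancy_le (hd0 : 0 ≤ d) (hd1 : d ≤ 1) (hζ : 0 ≤ ζ) (hδ : 0 ≤ δ)
    (hζδ : 6 * ζ ≤ δ ^ 2) (hn : 1 ≤ ζ * Fintype.card V) (hG : Quasirandom G ζ d) (P Q : V → ℝ)
    (hP : ∀ a, |P a| ≤ 1) (hQ : ∀ a, |Q a| ≤ 1) :
    |∑ a, ∑ b, (edgeInd G s(a, b) - d) * (P a * Q b)| ≤ δ * (Fintype.card V : ℝ) ^ 2 := by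
  refine abs_le_of_sq_le_sq ?_ (by positivity)
  calc _ ≤ 6 * ζ * (Fintype.card V : ℝ) ^ 4 := sq_discrepancy_le hd0 hd1 hG hζ hn P Q hP hQ
    _ ≤ δ ^ 2 * (Fintype.card V : ℝ) ^ 4 := by gcongr
    _ = _ := by ring

omit [Fintype W] in
lemma eq_of_subset_pair {K : Finset W} {x y : W} (h : K ⊆ {x, y}) :
    K = ∅ ∨ K = {x} ∨ K = {y} ∨ K = {x, y} := by
  rw [← coe_subset, coe_pair, Set.subset_pair_iff_eq] at h
  simpa only [← coe_inj, coe_empty, coe_singleton, coe_pair] using h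

omit [Fintype V] in
lemma LBounded.mono {l l' : ℝ} (h : LBounded G φ l) (hl : l ≤ l') : LBounded G φ l' :=
  fun v c => (h v c).trans hl

open Classical in
lemma abs_card_rainbowEmbedding_vertex_sub_le [Nonempty V] (hd0 : 0 ≤ d) (hd1 : d ≤ 1)
    (hζ : 0 ≤ ζ) (hδ : 0 ≤ δ) (hle : ζ ≤ δ) (hζδ : 6 * ζ ≤ δ ^ 2)
    (hn : 1 ≤ ζ * Fintype.card V) (hG : Quasirandom G ζ d)
    (hφ : LBounded G φ (ζ * Fintype.card V)) (x : W) (u : V) :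
    |(#{ψ ∈ rootedMaps {x} (fun _ => u) | IsRainbowEmbedding F G φ ψ} : ℝ) -
        d ^ #F.edgeFinset * (Fintype.card V : ℝ) ^ (Fintype.card W - 1)| ≤
      (#F.edgeFinset + (Fintype.card W : ℝ) ^ 2 + (#F.edgeFinset : ℝ) ^ 2) * δ *
        (Fintype.card V : ℝ) ^ (Fintype.card W - 1) := by
  have hle' : ζ * Fintype.card V ≤ δ * Fintype.card V := by gcongr
  have hout : ∀ e ∈ F.edgeSet, ¬ ∀ z ∈ e, z ∈ ({x} : Finset W) := by
    intro e he h
    induction e with | h a b =>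
    have ha := mem_singleton.1 (h a (by simp))
    have hb := mem_singleton.1 (h b (by simp))
    exact F.ne_of_adj he (ha.trans hb.symm)
  have := abs_card_rainbowEmbedding_sub_le (F := F) (S := {x}) (ρ := fun _ => u) hd0 hd1 hδ
    (abs_discrepancy_le hd0 hd1 hζ hδ hζδ hn hG)
    (fun z hz K hK _ => by
      rcases subset_singleton_iff.1 hK with rfl | rfl
      · simpa using by positivity
      · simpa [sum_edgeInd] using (abs_degree_sub_le hG u).trans hle')
    (by simp) (hn.trans hle') (LBounded.mono hφ hle')
    (fun e he h => absurd h (hout e he)) (fun e he _ _ h => absurd h (hout e he))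
    (fun z _ s hs t ht hst => absurd ((mem_singleton.1 hs).trans (mem_singleton.1 ht).symm) hst)
  have hE : ({e ∈ F.edgeFinset | ∃ z ∈ e, z ∉ ({x} : Finset W)} : Finset (Sym2 W)) =
      F.edgeFinset :=
    filter_true_of_mem fun e he => by simpa using hout e (SimpleGraph.mem_edgeFinset.1 he)
  rw [card_rootedMaps, card_singleton, hE] at this
  push_cast at this
  rwa [mul_assoc]

open Classical in
lemma abs_card_rainbowEmbedding_edge_sub_le [Nonempty V] (hd0 : 0 ≤ d) (hd1 : d ≤ 1)
    (hζ : 0 ≤ ζ) (hδ : 0 ≤ δ) (hle : ζ ≤ δ) (hζδ : 6 * ζ ≤ δ ^ 2)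
    (hn : 1 ≤ ζ * Fintype.card V) (hG : Quasirandom G ζ d)
    (hφ : LBounded G φ (ζ * Fintype.card V)) {v w : V} (hvw : G.Adj v w)
    (hreg : (|(codegIn G v w Set.univ : ℝ) - d ^ 2 * Fintype.card V| ≤ ζ * Fintype.card V ∧
      (monoCodeg G φ v w : ℝ) < ζ * Fintype.card V) ∨ F.CliqueFree 3) {x y : W}
    (hxy : F.Adj x y) :
    |(#{ψ ∈ rootedMaps {x, y} (fun z => if z = x then v else w) |
          IsRainbowEmbedding F G φ ψ} : ℝ) -
        d ^ (#F.edgeFinset - 1) * (Fintype.card V : ℝ) ^ (Fintype.card W - 2)| ≤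
      (#F.edgeFinset + (Fintype.card W : ℝ) ^ 2 + (#F.edgeFinset : ℝ) ^ 2) * δ *
        (Fintype.card V : ℝ) ^ (Fintype.card W - 2) := by
  have hle' : ζ * Fintype.card V ≤ δ * Fintype.card V := by gcongr
  have hne := F.ne_of_adj hxy
  have hreg' : ∀ z, F.Adj x z → F.Adj y z →
      |(codegIn G v w Set.univ : ℝ) - d ^ 2 * Fintype.card V| ≤ ζ * Fintype.card V ∧
        (monoCodeg G φ v w : ℝ) < ζ * Fintype.card V := fun z hxz hyz =>
    hreg.resolve_right fun h =>
      h {x, y, z} (SimpleGraph.is3Clique_triple_iff.2 ⟨hxy, hxz, hyz⟩)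
  have hin : ∀ e ∈ F.edgeSet, (∀ z ∈ e, z ∈ ({x, y} : Finset W)) → e = s(x, y) := by
    intro e he h
    induction e with | h a b =>
    have hab := F.ne_of_adj he
    have ha := h a (by simp)
    have hb := h b (by simp)
    simp only [mem_insert, mem_singleton] at ha hb
    rw [Sym2.eq_iff]
    grind
  have hmono_comm : monoCodeg G φ w v = monoCodeg G φ v w := by
    rw [monoCodeg, monoCodeg]
    congr 1
    ext z
    exact ⟨fun h => ⟨h.2.1, h.1, h.2.2.symm⟩, fun h => ⟨h.2.1, h.1, h.2.2.symm⟩⟩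
  have := abs_card_rainbowEmbedding_sub_le (F := F) (S := {x, y})
    (ρ := fun z => if z = x then v else w) hd0 hd1 hδ
    (abs_discrepancy_le hd0 hd1 hζ hδ hζδ hn hG)
    (fun z hz K hK hKz => by
      rcases eq_of_subset_pair hK with rfl | rfl | rfl | rfl
      · simpa using by positivity
      · simpa [sum_edgeInd] using (abs_degree_sub_le hG v).trans hle'
      · simpa [sum_edgeInd, hne.symm] using (abs_degree_sub_le hG w).trans hle'
      · have := (hreg' z (hKz x (by simp)) (hKz y (by simp))).1.trans hle'
        simpa [prod_pair hne, hne.symm, sum_edgeInd_mul_edgeInd, card_pair hne] using this)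
    (by
      intro a ha b hb hab
      have hvw' := G.ne_of_adj hvw
      simp only [coe_insert, coe_singleton, Set.mem_insert_iff, Set.mem_singleton_iff] at ha hb
      grind)
    (hn.trans hle') (LBounded.mono hφ hle')
    (fun e he h => by
      rw [hin e he h]
      simpa [hne.symm] using hvw)
    (fun e he e' he' h h' => (hin e he h).trans (hin e' he' h').symm)
    (fun z _ s hs t ht hst hsz htz => by
      simp only [mem_insert, mem_singleton] at hs ht
      rcases hs with rfl | rfl <;> rcases ht with rfl | rfl
      · exact absurd rfl hst
      · simpa [hne.symm] using (hreg' z hsz htz).2.le.trans hle'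
      · simpa [hne.symm, hmono_comm] using (hreg' z htz hsz).2.le.trans hle'
      · exact absurd rfl hst)
  have hE : ({e ∈ F.edgeFinset | ∃ z ∈ e, z ∉ ({x, y} : Finset W)} : Finset (Sym2 W)) =
      F.edgeFinset.erase s(x, y) := by
    ext e
    rw [mem_filter, mem_erase, and_comm]
    refine and_congr_left fun he => ⟨?_, fun h => ?_⟩
    · rintro ⟨z, hz, hzS⟩ rfl
      simp at hz hzS
      tauto
    · by_contra! h'
      exact h (hin e (SimpleGraph.mem_edgeFinset.1 he) h')
  rw [card_rootedMaps, card_pair hne, hE,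
    card_erase_of_mem (SimpleGraph.mem_edgeFinset.2 hxy)] at this
  push_cast at this
  rwa [mul_assoc]

end Count

lemma abs_sub_div_le_of_mul_eq_sum {ι : Type*} [Fintype ι] {R A : ℕ} (hA : 0 < A) {c : ι → ℕ}
    (h : R * A = ∑ i, c i) {T η : ℝ} (hc : ∀ i, |(c i : ℝ) - T| ≤ η * T) :
    |(R : ℝ) - Fintype.card ι * T / A| ≤ η * (Fintype.card ι * T / A) := by
  have hA' : (0 : ℝ) < A := Nat.cast_pos.2 hA
  have h' : (R : ℝ) * A = ∑ i, (c i : ℝ) := by exact_mod_cast h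
  have hsum : |(R : ℝ) * A - Fintype.card ι * T| ≤ η * (Fintype.card ι * T) := by
    calc |(R : ℝ) * A - Fintype.card ι * T| = |∑ i, ((c i : ℝ) - T)| := by
          rw [h', sum_sub_distrib, sum_const, card_univ, nsmul_eq_mul]
      _ ≤ ∑ i, |(c i : ℝ) - T| := abs_sum_le_sum_abs _ _
      _ ≤ ∑ _i : ι, η * T := sum_le_sum fun i _ => hc i
      _ = _ := by
          rw [sum_const, card_univ, nsmul_eq_mul]
          ring
  rw [show (R : ℝ) - Fintype.card ι * T / A = (R * A - Fintype.card ι * T) / A by field_simp,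
    abs_div, abs_of_pos hA', ← mul_div_assoc]
  gcongr

end RainbowCounting

/-- Lemma 2.4 (rainbow counting lemma for quasirandom graphs). -/
theorem stmt_10 :
    ∀ d : ℝ, 0 < d → d ≤ 1 → ∀ C f h : ℕ,
    ∃ ε₀ : ℝ, 0 < ε₀ ∧ ∀ ε : ℝ, 0 < ε → ε ≤ ε₀ →
    ∃ ζ₀ : ℝ, 0 < ζ₀ ∧ ∀ ζ : ℝ, 0 < ζ → ζ ≤ ζ₀ →
    ∃ n₀ : ℕ, ∀ n : ℕ, n₀ ≤ n →
    ∀ F : SimpleGraph (Fin f), F.edgeSet.ncard = h →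
    ∀ G : SimpleGraph (Fin n), Quasirandom G ζ d →
    ∀ φ : Sym2 (Fin n) → ℕ,
      GBounded G φ ((C : ℝ) * n) → LBounded G φ (ζ * n) →
    ∀ v w : Fin n, G.Adj v w →
      -- (A1): either vw is in neither irregularity graph, or F is triangle-free
      (((|(codegIn G v w Set.univ : ℝ) - d ^ 2 * n| ≤ ζ * n) ∧
        (monoCodeg G φ v w : ℝ) < ζ * n) ∨ F.CliqueFree 3) →
    ∀ u : Fin n,
      (|(rCountQ F G φ (fun H => u ∈ H.verts) : ℝ) -
          (f : ℝ) * d ^ h * (n : ℝ) ^ (f - 1) / (Nat.card (F ≃g F) : ℝ)|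
        ≤ (ε / 3) * ((f : ℝ) * d ^ h * (n : ℝ) ^ (f - 1) / (Nat.card (F ≃g F) : ℝ))) ∧
      (|(rCountQ F G φ (fun H => s(v, w) ∈ H.edgeSet) : ℝ) -
          2 * (h : ℝ) * d ^ (h - 1) * (n : ℝ) ^ (f - 2) / (Nat.card (F ≃g F) : ℝ)|
        ≤ (ε / 3) * (2 * (h : ℝ) * d ^ (h - 1) * (n : ℝ) ^ (f - 2) /
            (Nat.card (F ≃g F) : ℝ))) := by
  classical
  intro d hd0 hd1 C f h
  refine ⟨1, one_pos, fun ε hε _ => ?_⟩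
  set K : ℝ := h + (f : ℝ) ^ 2 + (h : ℝ) ^ 2 with hK
  have hK0 : 0 ≤ K := by positivity
  set δ : ℝ := ε / 3 * d ^ h / (K + 1) with hδdef
  have hδ : 0 < δ := by positivity
  have hKδ : K * δ ≤ ε / 3 * d ^ h := by
    rw [hδdef, mul_div_assoc', div_le_iff₀ (by positivity)]
    nlinarith [show 0 < ε / 3 * d ^ h by positivity]
  refine ⟨min δ (δ ^ 2 / 6), by positivity, fun ζ hζ hζ₀ => ⟨⌈1 / ζ⌉₊, ?_⟩⟩
  intro n hn F hF G hG φ _ hφ v w hvw hreg u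
  have : Nonempty (Fin n) := ⟨v⟩
  have hcardF : F.edgeFinset.card = h := by
    rw [← hF, ← SimpleGraph.coe_edgeFinset, Set.ncard_coe_finset]
  have hcardV : Fintype.card (Fin n) = n := Fintype.card_fin n
  have hcardW : Fintype.card (Fin f) = f := Fintype.card_fin f
  have hle : ζ ≤ δ := hζ₀.trans (min_le_left _ _)
  have hζδ : 6 * ζ ≤ δ ^ 2 := by linarith [hζ₀.trans (min_le_right _ _)]
  have hn1 : 1 ≤ ζ * n := by
    rw [← div_le_iff₀' hζ]
    exact (Nat.le_ceil _).trans (Nat.cast_le.2 hn)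
  have hA : 0 < Nat.card (F ≃g F) := by
    have : Finite (F ≃g F) := DFunLike.finite _
    have : Nonempty (F ≃g F) := ⟨.refl⟩
    exact Nat.card_pos
  have hn1' : 1 ≤ ζ * Fintype.card (Fin n) := by rwa [hcardV]
  have hφ' : LBounded G φ (ζ * Fintype.card (Fin n)) := by rwa [hcardV]
  have hreg' : (|(codegIn G v w Set.univ : ℝ) - d ^ 2 * Fintype.card (Fin n)| ≤
      ζ * Fintype.card (Fin n) ∧ (monoCodeg G φ v w : ℝ) < ζ * Fintype.card (Fin n)) ∨
      F.CliqueFree 3 := by rwa [hcardV]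
  constructor
  · have key := RainbowCounting.abs_sub_div_le_of_mul_eq_sum (η := ε / 3)
      (T := d ^ h * (n : ℝ) ^ (f - 1)) hA
      (RainbowCounting.rCountQ_vertex (F := F) (G := G) (φ := φ) u) fun x => by
        have := RainbowCounting.abs_card_rainbowEmbedding_vertex_sub_le (F := F) hd0.le hd1 hζ.le
          hδ.le hle hζδ hn1' hG hφ' x u
        rw [hcardF, hcardV, hcardW] at this
        refine this.trans ?_
        rw [← mul_assoc]
        gcongr
    rw [hcardW] at key
    simpa only [mul_assoc] using key
  · have key := RainbowCounting.abs_sub_div_le_of_mul_eq_sum (η := ε / 3)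
      (T := d ^ (h - 1) * (n : ℝ) ^ (f - 2)) hA
      (RainbowCounting.rCountQ_edge (F := F) (G := G) (φ := φ) (v := v) (w := w)) fun D => by
        have := RainbowCounting.abs_card_rainbowEmbedding_edge_sub_le hd0.le hd1 hζ.le
          hδ.le hle hζδ hn1' hG hφ' hvw hreg' D.adj
        rw [hcardF, hcardV, hcardW] at this
        refine this.trans ?_
        rw [← mul_assoc]
        have hpow : d ^ h ≤ d ^ (h - 1) :=
          pow_le_pow_of_le_one hd0.le hd1 (Nat.sub_le _ _)
        refine mul_le_mul_of_nonneg_right (hKδ.trans ?_) (by positivity)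
        gcongr
    rw [F.dart_card_eq_twice_card_edges, hcardF, Nat.cast_mul, Nat.cast_ofNat] at key
    simpa only [mul_assoc] using key
end
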